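/- arXiv:2305.05851 — 2 statements merged into one kernel-verified Lean document; each statement's English description precedes it below -/
import Mathlib

section
/- Let K = ℚ(√2) (the intermediate field ℚ⟮√2⟯ of ℝ/ℚ), let b₀ = 8 − 6√2 and c₀ = 2 − 2√2, and let W be the Tate normal form E(b₀,c₀): y² + (1−c₀)xy − b₀y = x³ − b₀x² over K. Then the torsion subgroup of the group of K-rational points of W is isomorphic to ℤ/11ℤ. -/
namespace WeierstrassCurve.Affine

section Valuation

variable {F Γ : Type*} [Field F] [LinearOrderedCommGroupWithZero Γ] {W : Affine F}
  {v : Valuation F Γ}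

/-- The valuation of the `x`-coordinate of an affine point, and `0` at the point at infinity. -/
def Point.xValuation (v : Valuation F Γ) : W.Point → Γ
  | 0 => 0
  | .some x _ _ => v x

/-- The coefficients of `W` are integral with respect to `v`. -/
structure IntegralCoeffs (W : Affine F) (v : Valuation F Γ) : Prop where
  a₁ : v W.a₁ ≤ 1
  a₂ : v W.a₂ ≤ 1
  a₃ : v W.a₃ ≤ 1
  a₄ : v W.a₄ ≤ 1
  a₆ : v W.a₆ ≤ 1

lemma valuation_mul_pow_lt {c x : F} (hc : v c ≤ 1) (hx : 1 < v x) {k n : ℕ} (hkn : k < n) :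
    v (c * x ^ k) < v x ^ n := by
  rw [map_mul, map_pow]
  exact (mul_le_of_le_one_left' hc).trans_lt (pow_lt_pow_right₀ hx hkn)

lemma valuation_cubic {a b c x : F} (ha : v a ≤ 1) (hb : v b ≤ 1) (hc : v c ≤ 1) (hx : 1 < v x)
    {k : F} (hk : v k = 1) : v (k * x ^ 3 + (a * x ^ 2 + b * x ^ 1 + c * x ^ 0)) = v x ^ 3 := by
  have hlead : v (k * x ^ 3) = v x ^ 3 := by rw [map_mul, hk, one_mul, map_pow]
  rw [Valuation.map_add_eq_of_lt_left, hlead]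
  rw [hlead]
  exact v.map_add_lt (v.map_add_lt (valuation_mul_pow_lt ha hx (by norm_num))
    (valuation_mul_pow_lt hb hx (by norm_num))) (valuation_mul_pow_lt hc hx (by norm_num))

namespace IntegralCoeffs

lemma b₂ (h : W.IntegralCoeffs v) : v W.b₂ ≤ 1 := by
  change W.b₂ ∈ v.integer
  exact add_mem (pow_mem h.a₁ 2) (mul_mem (ofNat_mem v.integer 4) h.a₂)

lemma b₄ (h : W.IntegralCoeffs v) : v W.b₄ ≤ 1 := by
  change W.b₄ ∈ v.integer
  exact add_mem (mul_mem (ofNat_mem v.integer 2) h.a₄) (mul_mem h.a₁ h.a₃)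

lemma b₆ (h : W.IntegralCoeffs v) : v W.b₆ ≤ 1 := by
  change W.b₆ ∈ v.integer
  exact add_mem (pow_mem h.a₃ 2) (mul_mem (ofNat_mem v.integer 4) h.a₆)

lemma b₈ (h : W.IntegralCoeffs v) : v W.b₈ ≤ 1 := by
  change W.b₈ ∈ v.integer
  exact sub_mem (add_mem (sub_mem (add_mem (mul_mem (pow_mem h.a₁ 2) h.a₆)
    (mul_mem (mul_mem (ofNat_mem v.integer 4) h.a₂) h.a₆))
    (mul_mem (mul_mem h.a₁ h.a₃) h.a₄)) (mul_mem h.a₂ (pow_mem h.a₃ 2))) (pow_mem h.a₄ 2)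

/-- A point with `y` of larger valuation than `max 1 (v x)` satisfies `v y ^ 2 = v (rhs)`. -/
lemma valuation_Y_sq (h : W.IntegralCoeffs v) {x y : F} (hy : 1 < v y) (hxy : v x < v y) :
    v (y ^ 2 + W.a₁ * x * y + W.a₃ * y) = v y ^ 2 := by
  have h0 : 0 < v y := zero_lt_one.trans hy
  rw [add_assoc, Valuation.map_add_eq_of_lt_left, map_pow]
  rw [map_pow, sq]
  refine v.map_add_lt ?_ ?_ <;> rw [map_mul, mul_lt_mul_iff_left₀ h0]
  · rw [map_mul]
    exact (mul_le_of_le_one_left' h.a₁).trans_lt hxy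
  · exact h.a₃.trans_lt hy

lemma valuation_Y_le_one (h : W.IntegralCoeffs v) {x y : F} (he : W.Equation x y)
    (hx : v x ≤ 1) : v y ≤ 1 := by
  by_contra! hy
  have hsq := h.valuation_Y_sq hy (hx.trans_lt hy)
  rw [(W.equation_iff x y).mp he] at hsq
  have hint : x ^ 3 + W.a₂ * x ^ 2 + W.a₄ * x + W.a₆ ∈ v.integer :=
    add_mem (add_mem (add_mem (pow_mem hx 3) (mul_mem h.a₂ (pow_mem hx 2))) (mul_mem h.a₄ hx)) h.a₆
  exact (hsq ▸ one_lt_pow₀ hy two_ne_zero).not_ge hint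

lemma valuation_Y_sq_eq_X_cube (h : W.IntegralCoeffs v) {x y : F} (he : W.Equation x y)
    (hx : 1 < v x) : v x < v y ∧ v y ^ 2 = v x ^ 3 := by
  have hX := valuation_cubic h.a₂ h.a₄ h.a₆ hx v.map_one
  have heq := (W.equation_iff x y).mp he
  have hxy : v x < v y := by
    by_contra! hyx
    have hle : v (y ^ 2 + W.a₁ * x * y + W.a₃ * y) ≤ v x ^ 2 := by
      refine v.map_add_le (v.map_add_le ?_ ?_) ?_
      · rw [map_pow]; gcongr
      · rw [map_mul, map_mul, sq]
        exact mul_le_mul' (mul_le_of_le_one_left' h.a₁) hyx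
      · rw [map_mul, sq]
        exact mul_le_mul' (h.a₃.trans hx.le) hyx
    rw [heq, show x ^ 3 + W.a₂ * x ^ 2 + W.a₄ * x + W.a₆ =
      1 * x ^ 3 + (W.a₂ * x ^ 2 + W.a₄ * x ^ 1 + W.a₆ * x ^ 0) by ring, hX] at hle
    exact hle.not_gt (pow_lt_pow_right₀ hx (by norm_num))
  refine ⟨hxy, ?_⟩
  rw [← h.valuation_Y_sq (hx.trans hxy) hxy, heq, ← hX]
  congr 1
  ring

end IntegralCoeffs

variable [DecidableEq F]

/-- The `x`-coordinates of the double and the triple of a point `(x, y)`: the double has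
`x`-coordinate `x + d`, and the triple is expressed in terms of `x` and `d`. -/
lemma Point.exists_three_nsmul_eq_some {x y : F} (hP : W.Nonsingular x y)
    (h₂ : 4 * x ^ 3 + W.b₂ * x ^ 2 + 2 * W.b₄ * x + W.b₆ ≠ 0)
    (h₃ : 3 * x ^ 4 + W.b₂ * x ^ 3 + 3 * W.b₄ * x ^ 2 + 3 * W.b₆ * x + W.b₈ ≠ 0) {d : F}
    (hd : d * (4 * x ^ 3 + W.b₂ * x ^ 2 + 2 * W.b₄ * x + W.b₆) =
      -(3 * x ^ 4 + W.b₂ * x ^ 3 + 3 * W.b₄ * x ^ 2 + 3 * W.b₆ * x + W.b₈)) :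
    ∃ y' h', 3 • some x y hP = some (x + (6 * x ^ 2 + W.b₂ * x + W.b₄) / d +
      (4 * x ^ 3 + W.b₂ * x ^ 2 + 2 * W.b₄ * x + W.b₆) / d ^ 2) y' h' := by
  have he := (W.equation_iff x y).mp hP.1
  have hψ : (2 * y + W.a₁ * x + W.a₃) ^ 2 =
      4 * x ^ 3 + W.b₂ * x ^ 2 + 2 * W.b₄ * x + W.b₆ := by
    simp only [WeierstrassCurve.b₂, WeierstrassCurve.b₄, WeierstrassCurve.b₆]
    linear_combination 4 * he
  have hψ0 : 2 * y + W.a₁ * x + W.a₃ ≠ 0 := fun h ↦ h₂ (by rw [← hψ, h]; ring)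
  have hy : y ≠ W.negY x y := fun h ↦ hψ0 (by rw [negY] at h; linear_combination h)
  have hd0 : d ≠ 0 := by
    rintro rfl
    exact h₃ (by linear_combination hd)
  set ℓ := W.slope x x y y with hℓ
  have hℓψ : ℓ * (2 * y + W.a₁ * x + W.a₃) =
      3 * x ^ 2 + 2 * W.a₂ * x + W.a₄ - W.a₁ * y := by
    rw [hℓ, slope_of_Y_ne rfl hy, show y - W.negY x y = 2 * y + W.a₁ * x + W.a₃ by rw [negY]; ring,
      div_mul_cancel₀ _ hψ0]
  have hx₂ : W.addX x x ℓ = x + d := by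
    refine mul_right_cancel₀ h₂ ?_
    rw [add_mul, hd, ← hψ, addX]
    have : (ℓ ^ 2 + W.a₁ * ℓ - W.a₂ - x - x) * (2 * y + W.a₁ * x + W.a₃) ^ 2 =
      (ℓ * (2 * y + W.a₁ * x + W.a₃)) ^ 2 + W.a₁ * (ℓ * (2 * y + W.a₁ * x + W.a₃)) *
        (2 * y + W.a₁ * x + W.a₃) - (W.a₂ + 2 * x) * (2 * y + W.a₁ * x + W.a₃) ^ 2 := by ring
    rw [this, hℓψ]
    simp only [WeierstrassCurve.b₂, WeierstrassCurve.b₄, WeierstrassCurve.b₆,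
      WeierstrassCurve.b₈]
    linear_combination -(W.a₁ ^ 2 + 4 * W.a₂ + 12 * x) * he
  have hne : W.addX x x ℓ ≠ x := by rwa [hx₂, ne_eq, add_eq_left]
  have hslope : W.slope (W.addX x x ℓ) x (W.addY x x y ℓ) y =
      -ℓ - W.a₁ - (2 * y + W.a₁ * x + W.a₃) / d := by
    rw [slope_of_X_ne hne, addY, negY, negAddY, hx₂, add_sub_cancel_left]
    field_simp
    ring
  have hx₃ : W.addX (W.addX x x ℓ) x (W.slope (W.addX x x ℓ) x (W.addY x x y ℓ) y) =
      x + (6 * x ^ 2 + W.b₂ * x + W.b₄) / d +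
        (4 * x ^ 3 + W.b₂ * x ^ 2 + 2 * W.b₄ * x + W.b₆) / d ^ 2 := by
    have hℓ₂ : (2 * ℓ + W.a₁) * (2 * y + W.a₁ * x + W.a₃) = 6 * x ^ 2 + W.b₂ * x + W.b₄ := by
      simp only [WeierstrassCurve.b₂, WeierstrassCurve.b₄]
      linear_combination 2 * hℓψ
    rw [hslope, hx₂, ← hψ, ← hℓ₂, addX]
    rw [addX] at hx₂
    field_simp
    linear_combination d ^ 2 * hx₂
  rw [← hx₃]
  refine ⟨_, nonsingular_add (nonsingular_add hP hP fun hxy ↦ hy hxy.right) hP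
    fun h ↦ hne h.left, ?_⟩
  rw [succ_nsmul, two_nsmul, add_self_of_Y_ne hy, add_of_X_ne hne]

/-- Tripling strictly increases the valuation of the `x`-coordinate of a point reducing to the
point at infinity, if `3` is a uniformizer. -/
lemma Point.xValuation_lt_three_nsmul (h : W.IntegralCoeffs v) (hv₂ : v 2 = 1) (hv₃ : v 3 < 1)
    (hv : ∀ t : F, 1 < v t → 1 ≤ v (3 * t)) {P : W.Point} (hP : 1 < P.xValuation v) :
    P.xValuation v < (3 • P).xValuation v := by
  match P, hP with
  | 0, hP => exact (not_lt_zero hP).elim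
  | .some x y hxy, hP =>
    change 1 < v x at hP
    have hx0 : 0 < v x := zero_lt_one.trans hP
    have hxne : x ≠ 0 := (v.ne_zero_iff).mp hx0.ne'
    have hv₃0 : 0 < v 3 := by
      by_contra! h0
      obtain ⟨hlt, -⟩ := h.valuation_Y_sq_eq_X_cube hxy.1 hP
      have := hv x hP
      rw [map_mul, le_zero_iff.mp h0, zero_mul] at this
      exact this.not_gt zero_lt_one
    have h3x : 1 < v 3 * v x := by
      obtain ⟨hlt, heq⟩ := h.valuation_Y_sq_eq_X_cube hxy.1 hP
      have hsq : v (y / x) ^ 2 = v x := by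
        rw [map_div₀, div_pow, heq, pow_succ' _ 2, mul_div_cancel_right₀ _ (pow_ne_zero 2 hx0.ne')]
      have ht : 1 < v (y / x) := by
        by_contra! hle
        exact hP.not_ge (hsq ▸ pow_le_one' hle 2)
      rw [← hsq, sq, ← mul_assoc, ← map_mul]
      exact ht.trans_le (le_mul_of_one_le_left' (hv _ ht))
    have int_ofNat (n : ℕ) [n.AtLeastTwo] : v (ofNat(n) : F) ≤ 1 := ofNat_mem v.integer n
    have int_mul {a b : F} (ha : v a ≤ 1) (hb : v b ≤ 1) : v (a * b) ≤ 1 :=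
      v.integer.mul_mem ha hb
    have hΨ₂ : v (4 * x ^ 3 + W.b₂ * x ^ 2 + 2 * W.b₄ * x + W.b₆) = v x ^ 3 := by
      rw [← valuation_cubic h.b₂ (int_mul (int_ofNat 2) h.b₄) h.b₆ hP
        (k := 4) (by rw [show (4 : F) = 2 * 2 by norm_num, map_mul, hv₂, one_mul])]
      congr 1
      ring
    have hΨ₃ : v (3 * x ^ 4 + W.b₂ * x ^ 3 + 3 * W.b₄ * x ^ 2 + 3 * W.b₆ * x + W.b₈) =
        v 3 * v x ^ 4 := by
      have hlt : v (W.b₂ * x ^ 3 + 3 * W.b₄ * x ^ 2 + 3 * W.b₆ * x ^ 1 + W.b₈ * x ^ 0) <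
          v (3 * x ^ 4) := by
        have hle : v (W.b₂ * x ^ 3 + 3 * W.b₄ * x ^ 2 + 3 * W.b₆ * x ^ 1 + W.b₈ * x ^ 0) ≤
            v x ^ 3 := by
          have aux {c : F} (hc : v c ≤ 1) {k : ℕ} (hk : k ≤ 3) : v (c * x ^ k) ≤ v x ^ 3 := by
            rw [map_mul, map_pow]
            exact (mul_le_of_le_one_left' hc).trans (pow_le_pow_right₀ hP.le hk)
          exact v.map_add_le (v.map_add_le (v.map_add_le (aux h.b₂ le_rfl)
            (aux (int_mul (int_ofNat 3) h.b₄) (by norm_num)))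
            (aux (int_mul (int_ofNat 3) h.b₆) (by norm_num))) (aux h.b₈ (by norm_num))
        refine hle.trans_lt ?_
        rw [map_mul, map_pow, pow_succ' _ 3, ← mul_assoc]
        exact lt_mul_of_one_lt_left (pow_pos hx0 3) h3x
      rw [← map_pow, ← map_mul, ← Valuation.map_add_eq_of_lt_left v hlt]
      congr 1
      ring
    have hΨ₂0 := (v.ne_zero_iff).mp (hΨ₂ ▸ (pow_pos hx0 3).ne')
    have hΨ₃0 := (v.ne_zero_iff).mp (hΨ₃ ▸ (mul_pos hv₃0 (pow_pos hx0 4)).ne')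
    obtain ⟨d, hd⟩ : ∃ d, d * (4 * x ^ 3 + W.b₂ * x ^ 2 + 2 * W.b₄ * x + W.b₆) =
        -(3 * x ^ 4 + W.b₂ * x ^ 3 + 3 * W.b₄ * x ^ 2 + 3 * W.b₆ * x + W.b₈) :=
      ⟨_, div_mul_cancel₀ _ hΨ₂0⟩
    have hvd : v d = v 3 * v x := by
      have := congrArg v hd
      rw [map_mul, v.map_neg, hΨ₂, hΨ₃, pow_succ' _ 3, ← mul_assoc] at this
      exact mul_right_cancel₀ (pow_ne_zero 3 hx0.ne') this
    obtain ⟨y', h', h3P⟩ := exists_three_nsmul_eq_some hxy hΨ₂0 hΨ₃0 hd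
    rw [h3P]
    change v x < v (_ + _)
    have hbig : v ((4 * x ^ 3 + W.b₂ * x ^ 2 + 2 * W.b₄ * x + W.b₆) / d ^ 2) =
        v x / v 3 ^ 2 := by
      rw [map_div₀, hΨ₂, map_pow, hvd, mul_pow, pow_succ' _ 2,
        mul_div_mul_right _ _ (pow_ne_zero 2 hx0.ne')]
    have hxlt : v x < v x / v 3 ^ 2 := by
      rw [lt_div_iff₀ (pow_pos hv₃0 2)]
      exact mul_lt_of_lt_one_right hx0 (pow_lt_one' hv₃ two_ne_zero)
    have hsmall : v (x + (6 * x ^ 2 + W.b₂ * x + W.b₄) / d) ≤ v x := by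
      refine v.map_add_le le_rfl ?_
      rw [map_div₀, hvd, div_le_iff₀ (mul_pos hv₃0 hx0)]
      have h3x' : v x ≤ v x * (v 3 * v x) := le_mul_of_one_le_right' h3x.le
      refine v.map_add_le (v.map_add_le ?_ ?_) ?_
      · rw [show (6 : F) = 2 * 3 by norm_num, map_mul, map_mul, hv₂, one_mul, map_pow]
        exact le_of_eq (by rw [sq, mul_left_comm])
      · rw [map_mul]
        exact (mul_le_of_le_one_left' h.b₂).trans h3x'
      · exact (h.b₄.trans hP.le).trans h3x'
    rw [Valuation.map_add_eq_of_lt_right v (hbig ▸ hsmall.trans_lt hxlt), hbig]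
    exact hxlt

lemma Point.xValuation_le_one_of_isOfFinAddOrder (h : W.IntegralCoeffs v) (hv₂ : v 2 = 1)
    (hv₃ : v 3 < 1) (hv : ∀ t : F, 1 < v t → 1 ≤ v (3 * t)) {P : W.Point}
    (hP : IsOfFinAddOrder P) : P.xValuation v ≤ 1 := by
  by_contra! hlt
  have hpow (n : ℕ) : 1 < (3 ^ n • P).xValuation v := by
    induction n with
    | zero => simpa using hlt
    | succ n ih =>
      rw [pow_succ', mul_smul]
      exact ih.trans (xValuation_lt_three_nsmul h hv₂ hv₃ hv ih)
  have hmono : StrictMono fun n : ℕ ↦ (3 ^ n • P).xValuation v := strictMono_nat_of_lt_succ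
    fun n ↦ by
      rw [pow_succ', mul_smul]
      exact xValuation_lt_three_nsmul h hv₂ hv₃ hv (hpow n)
  have hinj : Function.Injective fun n : ℕ ↦
      (⟨3 ^ n • P, (AddSubmonoid.mem_multiples_iff _ _).mpr ⟨_, rfl⟩⟩ : AddSubmonoid.multiples P) :=
    fun m n hmn ↦ hmono.injective (congrArg (xValuation v) (Subtype.ext_iff.mp hmn))
  have := (finite_multiples.mpr hP).to_subtype
  exact not_injective_infinite_finite _ hinj

/-- Two integral points with the same reduction, which is not a `2`-torsion point, are equal or
differ by a point reducing to the point at infinity. -/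
lemma Point.eq_or_one_lt_xValuation_sub (h : W.IntegralCoeffs v) {x₁ y₁ x₂ y₂ : F}
    {h₁ : W.Nonsingular x₁ y₁} {h₂ : W.Nonsingular x₂ y₂} (hx₁ : v x₁ ≤ 1) (hx₂ : v x₂ ≤ 1)
    (hx : v (x₁ - x₂) < 1) (hy : v (y₁ - y₂) < 1) (hψ : v (2 * y₁ + W.a₁ * x₁ + W.a₃) = 1) :
    some x₁ y₁ h₁ = some x₂ y₂ h₂ ∨ 1 < (some x₁ y₁ h₁ - some x₂ y₂ h₂).xValuation v := by
  by_cases hxx : x₁ = x₂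
  · subst hxx
    rcases Y_eq_of_X_eq h₁.1 h₂.1 rfl with hyy | hyy
    · left; subst hyy; rfl
    · exfalso
      refine hy.ne (hψ ▸ congrArg v ?_)
      rw [negY] at hyy
      linear_combination -hyy
  · right
    rw [sub_eq_add_neg, neg_some, add_of_X_ne hxx]
    change 1 < v (W.addX _ _ _)
    rw [slope_of_X_ne hxx]
    have hnum : v (y₁ - W.negY x₂ y₂) = 1 := by
      rw [show y₁ - W.negY x₂ y₂ = (2 * y₁ + W.a₁ * x₁ + W.a₃) -
        ((y₁ - y₂) + W.a₁ * (x₁ - x₂)) by rw [negY]; ring, Valuation.map_sub_eq_of_lt_left, hψ]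
      rw [hψ]
      refine v.map_add_lt hy ?_
      rw [map_mul]
      exact (mul_le_of_le_one_left' h.a₁).trans_lt hx
    have hℓ : 1 < v ((y₁ - W.negY x₂ y₂) / (x₁ - x₂)) := by
      rw [map_div₀, hnum, one_div]
      exact (one_lt_inv₀ (zero_lt_iff.mpr (v.ne_zero_iff.mpr (sub_ne_zero.mpr hxx)))).mpr hx
    set ℓ := (y₁ - W.negY x₂ y₂) / (x₁ - x₂)
    have hℓ0 : 0 < v ℓ := zero_lt_one.trans hℓ
    have hlt : v ℓ < v (ℓ ^ 2) := by
      rw [map_pow, sq]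
      exact lt_mul_of_one_lt_left hℓ0 hℓ
    rw [addX, show ℓ ^ 2 + W.a₁ * ℓ - W.a₂ - x₁ - x₂ =
      ℓ ^ 2 + (W.a₁ * ℓ - (W.a₂ + x₁ + x₂)) by ring, Valuation.map_add_eq_of_lt_left]
    · exact hℓ.trans hlt
    · refine lt_of_le_of_lt (v.map_sub_le ?_ ?_) hlt
      · rw [map_mul]
        exact mul_le_of_le_one_left' h.a₁
      · exact (v.map_add_le (v.map_add_le h.a₂ hx₁) hx₂).trans hℓ.le

end Valuation

end WeierstrassCurve.Affine

open scoped NNReal QuadraticAlgebra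

lemma padicInt_coe_ofNat (n : ℕ) [n.AtLeastTwo] :
    ((ofNat(n) : ℤ_[3]) : ℚ_[3]) = ofNat(n) := rfl

lemma padicInt_toZMod_eq_zero_iff (z : ℤ_[3]) : z.toZMod = 0 ↔ ‖(z : ℚ_[3])‖ < 1 := by
  rw [← RingHom.mem_ker, PadicInt.ker_toZMod]
  exact PadicInt.mem_nonunits

lemma nnnorm_sq_sub_two_mul_sq (p q : ℚ_[3]) :
    ‖p ^ 2 - 2 * q ^ 2‖₊ = max ‖p‖₊ ‖q‖₊ ^ 2 := by
  have h2 : ‖(2 : ℚ_[3])‖ = 1 := by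
    simpa using (Padic.norm_natCast_eq_one_iff (p := 3) (n := 2)).mpr (by norm_num)
  apply NNReal.eq
  push_cast
  by_cases hpq : ‖p‖ = ‖q‖
  · by_cases hq : q = 0
    · simp_all
    have hu : ‖p / q‖ = 1 := by rw [norm_div, hpq, div_self (norm_ne_zero_iff.mpr hq)]
    set u : ℤ_[3] := ⟨p / q, hu.le⟩ with hu_def
    have hunit : ‖u ^ 2 - 2‖ = 1 := by
      refine le_antisymm (PadicInt.norm_le_one _) ?_
      by_contra! hlt
      have hzero := (padicInt_toZMod_eq_zero_iff _).mpr hlt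
      rw [map_sub, map_pow, map_ofNat] at hzero
      generalize PadicInt.toZMod u = t at hzero
      revert t
      decide
    have hunit' : ‖(p / q) ^ 2 - 2‖ = 1 := by
      rwa [PadicInt.norm_def, PadicInt.coe_sub, PadicInt.coe_pow] at hunit
    rw [show p ^ 2 - 2 * q ^ 2 = ((p / q) ^ 2 - 2) * q ^ 2 by field_simp, norm_mul, hunit', one_mul,
      norm_pow, hpq, max_self]
  · have hne : ‖p ^ 2‖ ≠ ‖-(2 * q ^ 2)‖ := by
      rw [norm_neg, norm_mul, h2, one_mul, norm_pow, norm_pow]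
      exact fun h ↦ hpq ((sq_eq_sq₀ (norm_nonneg _) (norm_nonneg _)).mp h)
    rw [sub_eq_add_neg, Padic.add_eq_max_of_ne hne, norm_neg, norm_mul, h2, one_mul, norm_pow,
      norm_pow]
    rcases le_total ‖p‖ ‖q‖ with h | h
    · rw [max_eq_right h, max_eq_right (by gcongr)]
    · rw [max_eq_left h, max_eq_left (by gcongr)]

/-- The field `ℚ(√2)`, in coordinates. -/
abbrev QSqrtTwo := QuadraticAlgebra ℚ 2 0

namespace QSqrtTwo

lemma nnnorm_norm (z : QSqrtTwo) :
    ‖(z.norm : ℚ_[3])‖₊ = max ‖(z.re : ℚ_[3])‖₊ ‖(z.im : ℚ_[3])‖₊ ^ 2 := by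
  rw [← nnnorm_sq_sub_two_mul_sq, QuadraticAlgebra.norm_def]
  push_cast
  congr 1
  ring

/-- The valuation on `ℚ(√2)` attached to the inert prime `3`. -/
noncomputable def threeValuation : Valuation QSqrtTwo ℝ≥0 where
  toFun z := max ‖(z.re : ℚ_[3])‖₊ ‖(z.im : ℚ_[3])‖₊
  map_zero' := by simp
  map_one' := by simp
  map_mul' z w := by
    refine (pow_left_inj₀ (zero_le) (zero_le) two_ne_zero).mp ?_
    rw [mul_pow, ← nnnorm_norm, ← nnnorm_norm, ← nnnorm_norm, map_mul, Rat.cast_mul, nnnorm_mul]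
  map_add_le_max' z w := by
    simp only [QuadraticAlgebra.re_add, QuadraticAlgebra.im_add, Rat.cast_add]
    have hadd (a b : ℚ_[3]) : ‖a + b‖₊ ≤ max ‖a‖₊ ‖b‖₊ := Padic.nonarchimedean a b
    refine max_le ((hadd _ _).trans ?_) ((hadd _ _).trans ?_)
    · exact max_le_max (le_max_left _ _) (le_max_left _ _)
    · exact max_le_max (le_max_right _ _) (le_max_right _ _)

lemma threeValuation_apply (z : QSqrtTwo) :
    threeValuation z = max ‖(z.re : ℚ_[3])‖₊ ‖(z.im : ℚ_[3])‖₊ := rfl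

lemma threeValuation_le_one_iff (z : QSqrtTwo) :
    threeValuation z ≤ 1 ↔ ‖(z.re : ℚ_[3])‖ ≤ 1 ∧ ‖(z.im : ℚ_[3])‖ ≤ 1 := max_le_iff

lemma threeValuation_lt_one_iff (z : QSqrtTwo) :
    threeValuation z < 1 ↔ ‖(z.re : ℚ_[3])‖ < 1 ∧ ‖(z.im : ℚ_[3])‖ < 1 := max_lt_iff

lemma threeValuation_two : threeValuation 2 = 1 := by
  have h2 : ‖(2 : ℚ_[3])‖₊ = 1 := NNReal.eq <| by
    simpa using (Padic.norm_natCast_eq_one_iff (p := 3) (n := 2)).mpr (by norm_num)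
  simp [threeValuation_apply, h2]

lemma threeValuation_three : threeValuation 3 = 3⁻¹ := by
  have h3 : ‖(3 : ℚ_[3])‖₊ = 3⁻¹ := NNReal.eq <| by simpa using Padic.norm_p (p := 3)
  simp [threeValuation_apply, h3]

lemma one_le_threeValuation_three_mul {t : QSqrtTwo} (ht : 1 < threeValuation t) :
    1 ≤ threeValuation (3 * t) := by
  have aux (q : ℚ_[3]) (hq : 1 < ‖q‖₊) : 3 ≤ ‖q‖₊ := by
    by_contra! hlt
    refine hq.not_ge ?_
    have := (Padic.norm_le_pow_iff_norm_lt_pow_add_one q 0).mpr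
      (by simpa using NNReal.coe_lt_coe.mpr hlt)
    exact NNReal.coe_le_coe.mp (by simpa using this)
  rw [map_mul, threeValuation_three, threeValuation_apply]
  rw [threeValuation_apply, lt_max_iff] at ht
  have h3 : 3 ≤ max ‖(t.re : ℚ_[3])‖₊ ‖(t.im : ℚ_[3])‖₊ :=
    le_max_iff.mpr (ht.imp (aux _) (aux _))
  calc (1 : ℝ≥0) = 3⁻¹ * 3 := by norm_num
    _ ≤ _ := by gcongr

/-- The affine points `(x₀ + x₁√2, y₀ + y₁√2)` of the reduction modulo `3` of the curve
`E(8 - 6√2, 2 - 2√2)`. -/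
def reducedPoints : Finset (ZMod 3 × ZMod 3 × ZMod 3 × ZMod 3) :=
  {s | s.2.2.1 ^ 2 + 2 * s.2.2.2 ^ 2 - (s.1 * s.2.2.1 + 2 * s.2.1 * s.2.2.2)
        + 4 * (s.1 * s.2.2.2 + s.2.1 * s.2.2.1) + s.2.2.1 =
      s.1 ^ 3 + 6 * s.1 * s.2.1 ^ 2 + s.1 ^ 2 + 2 * s.2.1 ^ 2 ∧
    2 * s.2.2.1 * s.2.2.2 + 2 * (s.1 * s.2.2.1 + 2 * s.2.1 * s.2.2.2)
        - (s.1 * s.2.2.2 + s.2.1 * s.2.2.1) + s.2.2.2 =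
      3 * s.1 ^ 2 * s.2.1 + 2 * s.2.1 ^ 3 + 2 * s.1 * s.2.1}

lemma card_reducedPoints : reducedPoints.card = 10 := by decide +kernel

lemma ne_zero_of_mem_reducedPoints : ∀ s ∈ reducedPoints,
    ¬ (2 * s.2.2.1 - s.1 + 4 * s.2.1 + 1 = 0 ∧ 2 * s.2.2.2 + 2 * s.1 - s.2.1 = 0) := by
  decide +kernel

instance : Fact (∀ r : ℚ, r ^ 2 ≠ 2 + 0 * r) where
  out r hr := by
    have h := irrational_sqrt_two
    refine h ⟨|r|, ?_⟩
    have hr' : (r : ℝ) ^ 2 = 2 := by exact_mod_cast (by simpa using hr : r ^ 2 = 2)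
    rw [← hr', Real.sqrt_sq_eq_abs, Rat.cast_abs]

variable {F : Type*} [Field F] {e : F →+* QSqrtTwo} {b c : F} {W : WeierstrassCurve.Affine F}

lemma integralCoeffs (hb : e b = ⟨8, -6⟩) (hc : e c = ⟨2, -2⟩)
    (hW : W = { a₁ := 1 - c, a₂ := -b, a₃ := -b, a₄ := 0, a₆ := 0 }) :
    W.IntegralCoeffs (threeValuation.comap e) := by
  have int (m n : ℤ) : threeValuation ⟨m, n⟩ ≤ 1 := by
    rw [threeValuation_le_one_iff]
    simpa using ⟨Padic.norm_int_le_one m, Padic.norm_int_le_one n⟩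
  have hb' : threeValuation (e b) ≤ 1 := by simpa [hb] using int 8 (-6)
  have hc' : threeValuation (e c) ≤ 1 := by simpa [hc] using int 2 (-2)
  subst hW
  constructor <;> simp [Valuation.map_neg, hb']
  exact Valuation.map_sub_le _ (map_one _).le hc'

/-- Integral points of the curve reduce to `reducedPoints`. -/
lemma exists_mem_reducedPoints (hb : e b = ⟨8, -6⟩) (hc : e c = ⟨2, -2⟩)
    (hW : W = { a₁ := 1 - c, a₂ := -b, a₃ := -b, a₄ := 0, a₆ := 0 }) {x y : F}
    (h : W.Equation x y) (hx : threeValuation (e x) ≤ 1) (hy : threeValuation (e y) ≤ 1) :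
    ∃ x₀ x₁ y₀ y₁ : ℤ_[3], x₀ = ((e x).re : ℚ_[3]) ∧ x₁ = ((e x).im : ℚ_[3]) ∧
      y₀ = ((e y).re : ℚ_[3]) ∧ y₁ = ((e y).im : ℚ_[3]) ∧
      (x₀.toZMod, x₁.toZMod, y₀.toZMod, y₁.toZMod) ∈ reducedPoints := by
  rw [threeValuation_le_one_iff] at hx hy
  refine ⟨⟨_, hx.1⟩, ⟨_, hx.2⟩, ⟨_, hy.1⟩, ⟨_, hy.2⟩, rfl, rfl, rfl, rfl, ?_⟩
  set x₀ : ℤ_[3] := ⟨_, hx.1⟩ with hx₀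
  set x₁ : ℤ_[3] := ⟨_, hx.2⟩ with hx₁
  set y₀ : ℤ_[3] := ⟨_, hy.1⟩ with hy₀
  set y₁ : ℤ_[3] := ⟨_, hy.2⟩ with hy₁
  subst hW
  have heq := congrArg e ((WeierstrassCurve.Affine.equation_iff x y).mp h)
  simp only [map_add, map_mul, map_sub, map_pow, map_neg, map_one, map_zero, hb, hc] at heq
  have hre := congrArg (fun z ↦ ((z.re : ℚ) : ℚ_[3])) heq
  have him := congrArg (fun z ↦ ((z.im : ℚ) : ℚ_[3])) heq
  simp [pow_succ] at hre him
  have hre' : y₀ ^ 2 + 2 * y₁ ^ 2 - (x₀ * y₀ + 2 * x₁ * y₁) + 4 * (x₀ * y₁ + x₁ * y₀)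
      + (12 * y₁ - 8 * y₀) =
      x₀ ^ 3 + 6 * x₀ * x₁ ^ 2 - 8 * (x₀ ^ 2 + 2 * x₁ ^ 2) + 24 * x₀ * x₁ := by
    apply PadicInt.ext
    simp only [PadicInt.coe_add, PadicInt.coe_sub, PadicInt.coe_mul, PadicInt.coe_pow,
      padicInt_coe_ofNat]
    linear_combination hre
  have him' : 2 * y₀ * y₁ + 2 * (x₀ * y₀ + 2 * x₁ * y₁) - (x₀ * y₁ + x₁ * y₀)
      + (6 * y₀ - 8 * y₁) =
      3 * x₀ ^ 2 * x₁ + 2 * x₁ ^ 3 - 16 * x₀ * x₁ + 6 * (x₀ ^ 2 + 2 * x₁ ^ 2) := by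
    apply PadicInt.ext
    simp only [PadicInt.coe_add, PadicInt.coe_sub, PadicInt.coe_mul, PadicInt.coe_pow,
      padicInt_coe_ofNat]
    linear_combination him
  replace hre' := congrArg PadicInt.toZMod hre'
  replace him' := congrArg PadicInt.toZMod him'
  simp only [map_add, map_mul, map_sub, map_pow, map_ofNat] at hre' him'
  have h3 : (3 : ZMod 3) = 0 := rfl
  simp only [reducedPoints, Finset.mem_filter, Finset.mem_univ, true_and]
  constructor
  · linear_combination hre' + (3 * y₀.toZMod - 4 * y₁.toZMod - 3 * x₀.toZMod ^ 2
      - 6 * x₁.toZMod ^ 2 + 8 * x₀.toZMod * x₁.toZMod) * h3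
  · linear_combination him' + (3 * y₁.toZMod - 2 * y₀.toZMod
      - 6 * x₀.toZMod * x₁.toZMod + 2 * x₀.toZMod ^ 2 + 4 * x₁.toZMod ^ 2) * h3

/-- Points reducing to `reducedPoints` do not reduce to `2`-torsion points. -/
lemma threeValuation_two_mul_add (hb : e b = ⟨8, -6⟩) (hc : e c = ⟨2, -2⟩)
    (hW : W = { a₁ := 1 - c, a₂ := -b, a₃ := -b, a₄ := 0, a₆ := 0 }) {x y : F}
    {x₀ x₁ y₀ y₁ : ℤ_[3]} (hx₀ : x₀ = ((e x).re : ℚ_[3])) (hx₁ : x₁ = ((e x).im : ℚ_[3]))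
    (hy₀ : y₀ = ((e y).re : ℚ_[3])) (hy₁ : y₁ = ((e y).im : ℚ_[3]))
    (hs : (x₀.toZMod, x₁.toZMod, y₀.toZMod, y₁.toZMod) ∈ reducedPoints) :
    threeValuation (e (2 * y + W.a₁ * x + W.a₃)) = 1 := by
  have hre : ((2 * y₀ - x₀ + 4 * x₁ - 8 : ℤ_[3]) : ℚ_[3]) =
      ((e (2 * y + W.a₁ * x + W.a₃)).re : ℚ_[3]) := by
    simp [hW, hb, hc, padicInt_coe_ofNat, hx₀, hx₁, hy₀, map_ofNat e]
    ring
  have him : ((2 * y₁ - x₁ + 2 * x₀ + 6 : ℤ_[3]) : ℚ_[3]) =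
      ((e (2 * y + W.a₁ * x + W.a₃)).im : ℚ_[3]) := by
    simp [hW, hb, hc, padicInt_coe_ofNat, hx₀, hx₁, hy₁, map_ofNat e]
    ring
  refine le_antisymm ?_ ?_
  · rw [threeValuation_le_one_iff, ← hre, ← him]
    exact ⟨PadicInt.norm_le_one _, PadicInt.norm_le_one _⟩
  · by_contra! hlt
    rw [threeValuation_lt_one_iff, ← hre, ← him, ← padicInt_toZMod_eq_zero_iff,
      ← padicInt_toZMod_eq_zero_iff] at hlt
    simp only [map_add, map_sub, map_mul, map_ofNat] at hlt
    have h3 : (3 : ZMod 3) = 0 := rfl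
    refine ne_zero_of_mem_reducedPoints _ hs ⟨?_, ?_⟩
    · linear_combination hlt.1 + 3 * h3
    · linear_combination hlt.2 - 2 * h3

lemma threeValuation_sub_lt_one {z w : QSqrtTwo} {z₀ z₁ w₀ w₁ : ℤ_[3]}
    (hz₀ : z₀ = (z.re : ℚ_[3])) (hz₁ : z₁ = (z.im : ℚ_[3])) (hw₀ : w₀ = (w.re : ℚ_[3]))
    (hw₁ : w₁ = (w.im : ℚ_[3])) (h₀ : z₀.toZMod = w₀.toZMod) (h₁ : z₁.toZMod = w₁.toZMod) :
    threeValuation (z - w) < 1 := by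
  rw [← sub_eq_zero, ← map_sub, padicInt_toZMod_eq_zero_iff, PadicInt.coe_sub] at h₀ h₁
  rw [threeValuation_lt_one_iff, QuadraticAlgebra.re_sub, QuadraticAlgebra.im_sub, Rat.cast_sub,
    Rat.cast_sub, ← hz₀, ← hz₁, ← hw₀, ← hw₁]
  exact ⟨h₀, h₁⟩

open WeierstrassCurve.Affine in
lemma exists_injective_torsion [DecidableEq F] (hb : e b = ⟨8, -6⟩) (hc : e c = ⟨2, -2⟩)
    (hW : W = { a₁ := 1 - c, a₂ := -b, a₃ := -b, a₄ := 0, a₆ := 0 }) :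
    ∃ f : AddCommGroup.torsion W.Point → Option reducedPoints, Function.Injective f := by
  have hint := integralCoeffs hb hc hW
  have hfin (P : W.Point) (hP : IsOfFinAddOrder P) :
      P.xValuation (threeValuation.comap e) ≤ 1 := by
    refine Point.xValuation_le_one_of_isOfFinAddOrder hint ?_ ?_ (fun t ht ↦ ?_) hP
    · rw [Valuation.comap_apply, map_ofNat, threeValuation_two]
    · rw [Valuation.comap_apply, map_ofNat, threeValuation_three]
      exact inv_lt_one_of_one_lt₀ (by norm_num)
    · rw [Valuation.comap_apply, map_mul, map_ofNat]
      exact one_le_threeValuation_three_mul ht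
  have hex (P : AddCommGroup.torsion W.Point) : ∃ s : Option reducedPoints,
      (P.1 = 0 ∧ s = none) ∨ ∃ x y h, P.1 = .some x y h ∧ ∃ x₀ x₁ y₀ y₁ : ℤ_[3],
        x₀ = ((e x).re : ℚ_[3]) ∧ x₁ = ((e x).im : ℚ_[3]) ∧
        y₀ = ((e y).re : ℚ_[3]) ∧ y₁ = ((e y).im : ℚ_[3]) ∧
        ∃ hs, s = some ⟨(x₀.toZMod, x₁.toZMod, y₀.toZMod, y₁.toZMod), hs⟩ := by
    obtain ⟨P, hP⟩ := P
    match P, hP with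
    | 0, _ => exact ⟨none, .inl ⟨rfl, rfl⟩⟩
    | .some x y h, hP =>
      have hx := hfin _ hP
      obtain ⟨x₀, x₁, y₀, y₁, hx₀, hx₁, hy₀, hy₁, hs⟩ :=
        exists_mem_reducedPoints hb hc hW h.1 hx (hint.valuation_Y_le_one h.1 hx)
      exact ⟨_, .inr ⟨x, y, h, rfl, x₀, x₁, y₀, y₁, hx₀, hx₁, hy₀, hy₁, hs, rfl⟩⟩
  choose f hf using hex
  refine ⟨f, fun P Q hPQ ↦ Subtype.ext ?_⟩
  rcases hf P with ⟨hP, hfP⟩ | ⟨x, y, h, hP, x₀, x₁, y₀, y₁, hx₀, hx₁, hy₀, hy₁, hs, hfP⟩ <;>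
  rcases hf Q with ⟨hQ, hfQ⟩ |
    ⟨x', y', h', hQ, x₀', x₁', y₀', y₁', hx₀', hx₁', hy₀', hy₁', hs', hfQ⟩
  · rw [hP, hQ]
  · simp [hfP, hfQ] at hPQ
  · simp [hfP, hfQ] at hPQ
  · have hx := hfin _ P.2
    have hx' := hfin _ Q.2
    have hsub := hfin _ (sub_mem P.2 Q.2)
    rw [hP] at hx
    rw [hQ] at hx'
    rw [hP, hQ] at hsub ⊢
    rw [hfP, hfQ, Option.some_inj, Subtype.mk.injEq, Prod.mk.injEq, Prod.mk.injEq,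
      Prod.mk.injEq] at hPQ
    obtain ⟨h0, h1, h2, h3⟩ := hPQ
    refine (Point.eq_or_one_lt_xValuation_sub hint hx hx' ?_ ?_
      (threeValuation_two_mul_add hb hc hW hx₀ hx₁ hy₀ hy₁ hs)).resolve_right hsub.not_gt
    · rw [Valuation.comap_apply, map_sub]
      exact threeValuation_sub_lt_one hx₀ hx₁ hx₀' hx₁' h0 h1
    · rw [Valuation.comap_apply, map_sub]
      exact threeValuation_sub_lt_one hy₀ hy₁ hy₀' hy₁' h2 h3

end QSqrtTwo

namespace WeierstrassCurve.Affine

variable {F : Type*} [Field F] [DecidableEq F] {W : Affine F}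

lemma Point.add_eq_some {x₁ y₁ x₂ y₂ x₃ y₃ ℓ : F} (h₁ : W.Nonsingular x₁ y₁)
    (h₂ : W.Nonsingular x₂ y₂) (hx : x₁ ≠ x₂) (hℓ : ℓ * (x₁ - x₂) = y₁ - y₂)
    (hx₃ : x₃ = W.addX x₁ x₂ ℓ) (hy₃ : y₃ = W.addY x₁ x₂ y₁ ℓ) :
    ∃ h₃, some x₁ y₁ h₁ + some x₂ y₂ h₂ = some x₃ y₃ h₃ := by
  have : W.slope x₁ x₂ y₁ y₂ = ℓ := by
    rw [slope_of_X_ne hx, ← hℓ, mul_div_cancel_right₀ _ (sub_ne_zero.mpr hx)]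
  subst hx₃ hy₃ this
  exact ⟨_, add_of_X_ne hx⟩

lemma Point.add_self_eq_some {x₁ y₁ x₃ y₃ ℓ : F} (h₁ : W.Nonsingular x₁ y₁)
    (hy : 2 * y₁ + W.a₁ * x₁ + W.a₃ ≠ 0)
    (hℓ : ℓ * (2 * y₁ + W.a₁ * x₁ + W.a₃) = 3 * x₁ ^ 2 + 2 * W.a₂ * x₁ + W.a₄ - W.a₁ * y₁)
    (hx₃ : x₃ = W.addX x₁ x₁ ℓ) (hy₃ : y₃ = W.addY x₁ x₁ y₁ ℓ) :
    ∃ h₃, some x₁ y₁ h₁ + some x₁ y₁ h₁ = some x₃ y₃ h₃ := by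
  have hsub : y₁ - W.negY x₁ y₁ = 2 * y₁ + W.a₁ * x₁ + W.a₃ := by rw [negY]; ring
  have hne : y₁ ≠ W.negY x₁ y₁ := sub_ne_zero.mp (hsub ▸ hy)
  have : W.slope x₁ x₁ y₁ y₁ = ℓ := by
    rw [slope_of_Y_ne rfl hne, hsub, ← hℓ, mul_div_cancel_right₀ _ hy]
  subst hx₃ hy₃ this
  exact ⟨_, add_self_of_Y_ne hne⟩

/-- The point `(0, 0)` of the Tate normal form `E(8 - 6√2, 2 - 2√2)` has order `11`. -/
lemma exists_addOrderOf_eq_eleven [CharZero F] {s : F} (hs : s ^ 2 = 2)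
    (hW : W = { a₁ := 1 - (2 - 2 * s), a₂ := -(8 - 6 * s), a₃ := -(8 - 6 * s), a₄ := 0, a₆ := 0 }) :
    ∃ P : W.Point, addOrderOf P = 11 := by
  have hne : 8 - 6 * s ≠ 0 := fun h ↦ by
    have : (-8 : F) = 0 := by linear_combination (8 + 6 * s) * h + 36 * hs
    norm_num at this
  have ha₁ : W.a₁ = -1 + 2 * s := by rw [hW]; ring
  have ha₂ : W.a₂ = -8 + 6 * s := by rw [hW]; ring
  have ha₃ : W.a₃ = -8 + 6 * s := by rw [hW]; ring
  have ha₄ : W.a₄ = 0 := by rw [hW]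
  have ha₆ : W.a₆ = 0 := by rw [hW]
  have h₁ : W.Nonsingular 0 0 := by
    rw [nonsingular_zero, ha₃, ha₆]
    exact ⟨rfl, .inl fun h ↦ hne (by linear_combination -h)⟩
  obtain ⟨h₂, e₂⟩ := Point.add_self_eq_some (x₃ := 8 - 6 * s) (y₃ := 40 - 28 * s) (ℓ := 0) h₁
    (by rw [ha₃]; exact fun h ↦ hne (by linear_combination -h)) (by rw [ha₄]; ring)
    (by rw [addX, ha₂]; ring)
    (by rw [addY, negY, negAddY, addX, ha₁, ha₂, ha₃]; linear_combination -12 * hs)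
  obtain ⟨h₃, e₃⟩ := Point.add_eq_some (x₃ := 2 - 2 * s) (y₃ := 6 - 4 * s) (ℓ := 2 - 2 * s) h₂ h₁
    (fun h ↦ hne h) (by linear_combination 12 * hs)
    (by rw [addX, ha₁, ha₂]; ring)
    (by rw [addY, negY, negAddY, addX, ha₁, ha₂, ha₃]; linear_combination -12 * hs)
  obtain ⟨h₅, e₅⟩ := Point.add_eq_some (x₃ := 4 - 2 * s) (y₃ := 8 - 8 * s) (ℓ := 3 - 2 * s) h₃ h₂
    (fun h ↦ by
      have : (-4 : F) = 0 := by linear_combination (4 * s + 6) * h - 16 * hs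
      norm_num at this)
    (by linear_combination -8 * hs)
    (by rw [addX, ha₁, ha₂]; ring)
    (by rw [addY, negY, negAddY, addX, ha₁, ha₂, ha₃]; linear_combination -4 * hs)
  obtain ⟨h₆, e₆⟩ := Point.add_self_eq_some (x₃ := 4 - 2 * s) (y₃ := 12 - 8 * s) (ℓ := 1 - 2 * s) h₃
    (fun h ↦ by
      rw [ha₁, ha₃] at h
      have : (-4 : F) = 0 := by linear_combination (4 * s + 6) * h + (16 * s + 8) * hs
      norm_num at this)
    (by rw [ha₁, ha₂, ha₃, ha₄]; linear_combination (8 * s - 8) * hs)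
    (by rw [addX, ha₁, ha₂]; ring)
    (by rw [addY, negY, negAddY, addX, ha₁, ha₂, ha₃]; linear_combination -4 * hs)
  have e₁₁ := Point.add_of_Y_eq (h₁ := h₅) (h₂ := h₆) rfl
    (by rw [negY, ha₁, ha₃]; linear_combination -4 * hs)
  have : Fact (Nat.Prime 11) := ⟨by norm_num⟩
  refine ⟨.some 0 0 h₁, addOrderOf_eq_prime (p := 11) ?_ (Point.some_ne_zero h₁)⟩
  generalize Point.some 0 0 h₁ = P at *
  calc 11 • P = P + P + P + (P + P) + (P + P + P + (P + P + P)) := by abel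
    _ = 0 := by rw [e₂, e₃, e₅, e₆, e₁₁]

end WeierstrassCurve.Affine

open WeierstrassCurve.Affine in
lemma nonempty_torsion_addEquiv_zmod {F : Type*} [Field F] [DecidableEq F] [CharZero F]
    (e : F ≃+* QSqrtTwo) {b c : F} (hb : e b = ⟨8, -6⟩) (hc : e c = ⟨2, -2⟩)
    {W : WeierstrassCurve.Affine F}
    (hW : W = { a₁ := 1 - c, a₂ := -b, a₃ := -b, a₄ := 0, a₆ := 0 }) :
    Nonempty (AddCommGroup.torsion W.Point ≃+ ZMod 11) := by
  obtain ⟨f, hf⟩ := QSqrtTwo.exists_injective_torsion (e := (e : F →+* QSqrtTwo)) hb hc hW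
  have hfinite := Finite.of_injective f hf
  have hle : Nat.card (AddCommGroup.torsion W.Point) ≤ 11 := by
    simpa [Finite.card_option, QSqrtTwo.card_reducedPoints] using Nat.card_le_card_of_injective f hf
  have hs : e (e.symm ⟨0, 1⟩) = ⟨0, 1⟩ := e.apply_symm_apply _
  have hbs : b = 8 - 6 * e.symm ⟨0, 1⟩ := e.injective (by
    rw [map_sub, map_mul, map_ofNat, map_ofNat, hs, hb]
    ext <;> simp)
  have hcs : c = 2 - 2 * e.symm ⟨0, 1⟩ := e.injective (by
    rw [map_sub, map_mul, map_ofNat, hs, hc]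
    ext <;> simp)
  obtain ⟨P, hP⟩ := exists_addOrderOf_eq_eleven (W := W) (s := e.symm ⟨0, 1⟩)
    (e.injective (by
      rw [map_pow, hs, map_ofNat]
      ext <;> simp [pow_succ])) (by
      rw [hW, hbs, hcs])
  have hPfin : P ∈ AddCommGroup.torsion W.Point :=
    addOrderOf_pos_iff.mp (by rw [hP]; norm_num)
  have hdvd : 11 ∣ Nat.card (AddCommGroup.torsion W.Point) := by
    rw [← hP, ← AddSubgroup.addOrderOf_mk P hPfin]
    exact addOrderOf_dvd_natCard _
  have hcard : Nat.card (AddCommGroup.torsion W.Point) = 11 :=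
    le_antisymm hle (Nat.le_of_dvd Nat.card_pos hdvd)
  have : Fact (Nat.Prime 11) := ⟨by norm_num⟩
  have hcyc := isAddCyclic_of_prime_card hcard
  exact ⟨(hcard ▸ zmodAddCyclicAddEquiv hcyc).symm⟩

open scoped IntermediateField

/-- Let `K = ℚ(√2)`, `b₀ = 8 - 6√2`, `c₀ = 2 - 2√2`, and let `W` be the
Tate normal form `E(b₀,c₀)` over `K`. Then the torsion subgroup of the group of `K`-rational
points of `W` is isomorphic to `ℤ/11ℤ`. -/
theorem tate_normal_form_torsion_eleven
    (K : IntermediateField ℚ ℝ) (hK : K = ℚ⟮Real.sqrt 2⟯)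
    (b₀ c₀ : K)
    (hb₀ : (b₀ : ℝ) = 8 - 6 * Real.sqrt 2) (hc₀ : (c₀ : ℝ) = 2 - 2 * Real.sqrt 2)
    (W : WeierstrassCurve.Affine K)
    (hW : W = { a₁ := 1 - c₀, a₂ := -b₀, a₃ := -b₀, a₄ := 0, a₆ := 0 }) :
    Nonempty (AddCommGroup.torsion W.Point ≃+ ZMod 11) := by
  have hmem : √2 ∈ K := hK ▸ IntermediateField.mem_adjoin_simple_self ℚ (√2)
  let s : K := ⟨√2, hmem⟩
  have hs : s * s = 2 := Subtype.ext (Real.mul_self_sqrt zero_le_two)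
  let φ : QSqrtTwo →+* K :=
    { toFun z := (z.re : K) + z.im * s
      map_zero' := by simp
      map_one' := by simp
      map_add' z w := by
        simp only [QuadraticAlgebra.re_add, QuadraticAlgebra.im_add, Rat.cast_add]
        ring
      map_mul' z w := by
        simp only [QuadraticAlgebra.re_mul, QuadraticAlgebra.im_mul, Rat.cast_add, Rat.cast_mul,
          Rat.cast_ofNat, zero_mul, add_zero]
        linear_combination -(z.im * w.im : K) * hs }
  have hφ (z : QSqrtTwo) : (φ z : ℝ) = z.re + z.im * √2 := by
    simp [φ, s]
  have hle (x : ℝ) (hx : x ∈ ℚ⟮√2⟯) : ∃ z, (φ z : ℝ) = x := by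
    induction hx using IntermediateField.adjoin_induction with
    | mem x hx => exact ⟨⟨0, 1⟩, by simp [hφ, Set.mem_singleton_iff.mp hx]⟩
    | algebraMap q => exact ⟨⟨q, 0⟩, by simp [hφ]⟩
    | add x y _ _ hx hy =>
      obtain ⟨⟨z, rfl⟩, ⟨w, rfl⟩⟩ := And.intro hx hy
      exact ⟨z + w, by rw [map_add]; rfl⟩
    | inv x _ hx =>
      obtain ⟨z, rfl⟩ := hx
      exact ⟨z⁻¹, by rw [map_inv₀]; rfl⟩
    | mul x y _ _ hx hy =>
      obtain ⟨⟨z, rfl⟩, ⟨w, rfl⟩⟩ := And.intro hx hy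
      exact ⟨z * w, by rw [map_mul]; rfl⟩
  have hsurj : Function.Surjective φ := fun x ↦ by
    obtain ⟨z, hz⟩ := hle x (hK ▸ x.2)
    exact ⟨z, Subtype.ext hz⟩
  let e : QSqrtTwo ≃+* K := RingEquiv.ofBijective φ ⟨φ.injective, hsurj⟩
  refine nonempty_torsion_addEquiv_zmod e.symm (b := b₀) (c := c₀) ?_ ?_ hW <;>
    rw [RingEquiv.symm_apply_eq] <;> apply Subtype.ext
  · rw [hb₀]
    refine Eq.trans ?_ (hφ _).symm
    push_cast
    ring
  · rw [hc₀]
    refine Eq.trans ?_ (hφ _).symm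
    push_cast
    ring
end

section
/- Let α ∈ ℂ be a root of 2x⁴ − 5x³ − 7x² + 10x + 8 and let K = ℚ(α). Set b₁ = −(1337/32)α³ + (3233/64)α² + (12285/64)α + 1135/16 and c₁ = −(59/16)α³ + (147/32)α² + (535/32)α + 45/8, and let W be the Tate normal form E(b₁,c₁): y² + (1−c₁)xy − b₁y = x³ − b₁x² over K. Then the torsion subgroup of the group of K-rational points of W is isomorphic to ℤ/17ℤ; thus W is an elliptic curve over a cyclic quartic number field with torsion subgroup ℤ/17ℤ. -/
open scoped IntermediateField

open Polynomial in
/-- The four roots of `2x⁴ - 5x³ - 7x² + 10x + 8` are polynomials in any one of them, so the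
polynomial splits as soon as it has a root. -/
theorem splits_quartic_of_root {F : Type*} [Field F] [CharZero F] {β : F}
    (hβ : 2 * β ^ 4 - 5 * β ^ 3 - 7 * β ^ 2 + 10 * β + 8 = 0) :
    (C 2 * X ^ 4 - C 5 * X ^ 3 - C 7 * X ^ 2 + C 10 * X + C 8 : F[X]).Splits := by
  have hf : (C 2 * X ^ 4 - C 5 * X ^ 3 - C 7 * X ^ 2 + C 10 * X + C 8 : F[X]) =
      C 2 * ((X - C β) * (X - C (3 + 3 / 2 * β - β ^ 2)) *
        (X - C (-3 - 3 / 4 * β + 9 / 4 * β ^ 2 - 1 / 2 * β ^ 3)) *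
        (X - C (5 / 2 - 7 / 4 * β - 5 / 4 * β ^ 2 + 1 / 2 * β ^ 3))) := by
    refine Polynomial.funext fun x => ?_
    simp only [eval_add, eval_sub, eval_mul, eval_pow, eval_X, eval_C]
    linear_combination (1 + 35 / 8 * β - 69 / 16 * β ^ 2 - 21 / 16 * β ^ 3 + 3 / 2 * β ^ 4
      - 1 / 4 * β ^ 5 + x * (-35 / 8 + 47 / 16 * β + 39 / 16 * β ^ 2 - 7 / 4 * β ^ 3
      + 1 / 4 * β ^ 4) + x ^ 2 * (11 / 8 - 9 / 8 * β + 1 / 4 * β ^ 2)) * hβ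
  rw [hf]
  exact (Splits.C _).mul ((((Splits.X_sub_C _).mul (Splits.X_sub_C _)).mul
    (Splits.X_sub_C _)).mul (Splits.X_sub_C _))

open Polynomial in
theorem exists_root_quartic_padicInt {p : ℕ} [Fact p.Prime] (r : ℤ)
    (hr : (p : ℤ) ∣ 2 * r ^ 4 - 5 * r ^ 3 - 7 * r ^ 2 + 10 * r + 8)
    (hr' : ¬ (p : ℤ) ∣ 8 * r ^ 3 - 15 * r ^ 2 - 14 * r + 10) :
    ∃ β : ℤ_[p], 2 * β ^ 4 - 5 * β ^ 3 - 7 * β ^ 2 + 10 * β + 8 = 0 := by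
  have h0 : ∀ z : ℤ_[p], (C 2 * X ^ 4 - C 5 * X ^ 3 - C 7 * X ^ 2 + C 10 * X + C 8 :
      ℤ_[p][X]).aeval z = 2 * z ^ 4 - 5 * z ^ 3 - 7 * z ^ 2 + 10 * z + 8 := by
    intro z; simp
  have h1 : (derivative (C 2 * X ^ 4 - C 5 * X ^ 3 - C 7 * X ^ 2 + C 10 * X + C 8 :
      ℤ_[p][X])).aeval (r : ℤ_[p]) = ((8 * r ^ 3 - 15 * r ^ 2 - 14 * r + 10 : ℤ) : ℤ_[p]) := by
    simp only [derivative_C_mul, derivative_X_pow, derivative_C,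
      derivative_X, map_add, map_sub, map_mul, aeval_C, aeval_X, map_pow, map_zero, map_one]
    push_cast
    simp
    ring
  obtain ⟨z, hz, -⟩ := hensels_lemma (p := p) (R := ℤ_[p]) (a := (r : ℤ_[p]))
    (F := (C 2 * X ^ 4 - C 5 * X ^ 3 - C 7 * X ^ 2 + C 10 * X + C 8 : ℤ_[p][X])) (by
      rw [h1, h0]
      have h2 : ‖((8 * r ^ 3 - 15 * r ^ 2 - 14 * r + 10 : ℤ) : ℤ_[p])‖ = 1 :=
        le_antisymm (PadicInt.norm_le_one _)
          (not_lt.mp fun h => hr' ((PadicInt.norm_int_lt_one_iff_dvd _).mp h))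
      rw [h2, one_pow]
      have := (PadicInt.norm_int_lt_one_iff_dvd (p := p) _).mpr hr
      push_cast at this
      exact this)
  exact ⟨z, by rw [← h0]; exact hz⟩

open Polynomial in
theorem exists_ringHom_adjoin_padic {p : ℕ} [Fact p.Prime] (hp : p ≠ 2) (r : ℤ)
    (hr : (p : ℤ) ∣ 2 * r ^ 4 - 5 * r ^ 3 - 7 * r ^ 2 + 10 * r + 8)
    (hr' : ¬ (p : ℤ) ∣ 8 * r ^ 3 - 15 * r ^ 2 - 14 * r + 10)
    {α : ℂ} (hα : 2 * α ^ 4 - 5 * α ^ 3 - 7 * α ^ 2 + 10 * α + 8 = 0) :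
    ∃ (φ : ℚ⟮α⟯ →+* ℚ_[p]) (β : ℤ_[p]), φ (IntermediateField.AdjoinSimple.gen ℚ α) = β := by
  obtain ⟨β, hβ⟩ := exists_root_quartic_padicInt r hr hr'
  have hβ' : 2 * (β : ℚ_[p]) ^ 4 - 5 * (β : ℚ_[p]) ^ 3 - 7 * (β : ℚ_[p]) ^ 2
      + 10 * (β : ℚ_[p]) + 8 = 0 := mod_cast congrArg (fun z : ℤ_[p] => (z : ℚ_[p])) hβ
  have hs := splits_quartic_of_root hβ'
  set f : ℚ[X] := C 2 * X ^ 4 - C 5 * X ^ 3 - C 7 * X ^ 2 + C 10 * X + C 8 with hf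
  have hf0 : f ≠ 0 := by
    intro h
    have := congrArg (eval 0) h
    simp [hf] at this
  have hfmap : f.map (algebraMap ℚ ℚ_[p]) =
      C 2 * X ^ 4 - C 5 * X ^ 3 - C 7 * X ^ 2 + C 10 * X + C 8 := by
    simp [hf]
  rw [← hfmap] at hs
  have hfα : aeval α f = 0 := by
    rw [← hα]; simp [hf]
  have hkint : IsIntegral ℚ α := isAlgebraic_iff_isIntegral.mp ⟨f, hf0, hfα⟩
  have hsm : ((minpoly ℚ α).map (algebraMap ℚ ℚ_[p])).Splits :=
    hs.of_dvd (Polynomial.map_ne_zero hf0) (Polynomial.map_dvd _ (minpoly.dvd ℚ α hfα))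
  obtain ⟨φ⟩ := IntermediateField.nonempty_algHom_adjoin_of_splits (F := ℚ) (S := {α})
    (K := ℚ_[p]) (fun s hs => by
      rw [Set.mem_singleton_iff.mp hs]; exact ⟨hkint, hsm⟩)
  have hγ : aeval (φ (IntermediateField.AdjoinSimple.gen ℚ α)) f = 0 := by
    have h : aeval (IntermediateField.AdjoinSimple.gen ℚ α) f = 0 :=
      Subtype.val_injective ((aeval_algHom_apply ℚ⟮α⟯.val _ f).symm.trans hfα)
    rw [aeval_algHom_apply, h, map_zero]
  refine ⟨φ, ?_⟩
  rw [RingHom.coe_coe]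
  generalize φ (IntermediateField.AdjoinSimple.gen ℚ α) = γ at hγ
  have hγ' : 2 * γ ^ 4 - 5 * γ ^ 3 - 7 * γ ^ 2 + 10 * γ + 8 = 0 := by
    rw [← hγ]; simp [hf]
  suffices h : ‖γ‖ ≤ 1 from ⟨⟨γ, h⟩, rfl⟩
  by_contra! h
  have h2 : ‖(2 : ℚ_[p])‖ = 1 := by
    refine le_antisymm (by simpa using Padic.norm_int_le_one (p := p) 2) (not_lt.mp fun h2 => hp ?_)
    have := (Padic.norm_intCast_lt_one_iff (p := p) (k := 2)).mp (by simpa using h2)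
    exact (Nat.prime_dvd_prime_iff_eq Fact.out Nat.prime_two).mp (by exact_mod_cast this)
  have hn : ∀ k : ℤ, ∀ n < 4, ‖(k : ℚ_[p]) * γ ^ n‖ < ‖γ‖ ^ 4 := by
    intro k n hn
    rw [norm_mul, norm_pow]
    calc ‖(k : ℚ_[p])‖ * ‖γ‖ ^ n ≤ 1 * ‖γ‖ ^ n := by
          gcongr; exact Padic.norm_int_le_one k
      _ < ‖γ‖ ^ 4 := by rw [one_mul]; exact pow_lt_pow_right₀ h hn
  have hadd : ∀ {a b : ℚ_[p]}, ‖a‖ < ‖γ‖ ^ 4 → ‖b‖ < ‖γ‖ ^ 4 → ‖a + b‖ < ‖γ‖ ^ 4 :=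
    fun ha hb => (Padic.nonarchimedean _ _).trans_lt (max_lt ha hb)
  have hlt := hadd (hadd (hn 5 3 (by norm_num)) (hn 7 2 (by norm_num)))
    (hadd (hn (-10) 1 (by norm_num)) (hn (-8) 0 (by norm_num)))
  have heq : ((5 : ℤ) : ℚ_[p]) * γ ^ 3 + ((7 : ℤ) : ℚ_[p]) * γ ^ 2 +
      (((-10 : ℤ) : ℚ_[p]) * γ ^ 1 + ((-8 : ℤ) : ℚ_[p]) * γ ^ 0) = 2 * γ ^ 4 := by
    push_cast
    linear_combination -hγ'
  rw [heq, norm_mul, norm_pow, h2, one_mul] at hlt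
  exact lt_irrefl _ hlt

namespace AbsoluteValue

variable {F : Type*} [Field F] {v : AbsoluteValue F ℝ}

theorem add_le_of_le (hna : IsNonarchimedean v) {x y : F} {r : ℝ} (hx : v x ≤ r) (hy : v y ≤ r) :
    v (x + y) ≤ r :=
  (hna x y).trans (max_le hx hy)

theorem sub_le_of_le (hna : IsNonarchimedean v) {x y : F} {r : ℝ} (hx : v x ≤ r) (hy : v y ≤ r) :
    v (x - y) ≤ r := by
  rw [sub_eq_add_neg]
  exact add_le_of_le hna hx (by rwa [v.map_neg])

theorem mul_le_of_le {x y : F} {r s : ℝ} (hx : v x ≤ r) (hy : v y ≤ s) : v (x * y) ≤ r * s := by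
  rw [v.map_mul]
  exact mul_le_mul hx hy (v.nonneg _) ((v.nonneg _).trans hx)

theorem int_mul_le {a y : F} {s : ℝ} (ha : v a ≤ 1) (hy : v y ≤ s) : v (a * y) ≤ s := by
  simpa using mul_le_of_le ha hy

theorem natCast_le_one (hna : IsNonarchimedean v) (n : ℕ) : v (n : F) ≤ 1 := by
  induction n with
  | zero => simp
  | succ n ih =>
    push_cast
    exact add_le_of_le hna ih (by simp)

theorem ofNat_le_one (hna : IsNonarchimedean v) (n : ℕ) [n.AtLeastTwo] :
    v (OfNat.ofNat n : F) ≤ 1 := by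
  exact_mod_cast natCast_le_one hna (OfNat.ofNat n)

theorem add_eq_of_lt (hna : IsNonarchimedean v) {x y : F} (h : v y < v x) : v (x + y) = v x :=
  IsNonarchimedean.add_eq_left_of_lt hna h

end AbsoluteValue

section Cubic

open AbsoluteValue

variable {F : Type*} [Field F] {v : AbsoluteValue F ℝ} {b₂ b₄ b₆ : F} {r : ℝ}

theorem cubic_rest_le (hna : IsNonarchimedean v) (h₂ : v b₂ ≤ 1) (h₄ : v b₄ ≤ 1) (h₆ : v b₆ ≤ 1)
    {x : F} (hx : 1 ≤ v x) : v (b₂ * x ^ 2 + (2 * b₄ * x + b₆)) ≤ v x ^ 2 := by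
  have h1 : v x ≤ v x ^ 2 := by nlinarith
  refine add_le_of_le hna (int_mul_le h₂ (v.map_pow x 2).le) (add_le_of_le hna ?_ ?_)
  · exact (int_mul_le (int_mul_le (ofNat_le_one hna 2) h₄) le_rfl).trans h1
  · exact h₆.trans (hx.trans h1)

theorem abv_cubic (hna : IsNonarchimedean v) (hv2 : v 2 = 1)
    (h₂ : v b₂ ≤ 1) (h₄ : v b₄ ≤ 1) (h₆ : v b₆ ≤ 1) {x : F} (hx : 1 < v x) :
    v (4 * x ^ 3 + b₂ * x ^ 2 + 2 * b₄ * x + b₆) = v x ^ 3 := by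
  have hv4 : v (4 * x ^ 3) = v x ^ 3 := by
    rw [show (4 : F) = 2 * 2 by norm_num, v.map_mul, v.map_mul, hv2, v.map_pow]; ring
  rw [show 4 * x ^ 3 + b₂ * x ^ 2 + 2 * b₄ * x + b₆ =
    4 * x ^ 3 + (b₂ * x ^ 2 + (2 * b₄ * x + b₆)) by ring, add_eq_of_lt hna, hv4]
  rw [hv4]
  exact (cubic_rest_le hna h₂ h₄ h₆ hx.le).trans_lt (pow_lt_pow_right₀ hx (by norm_num))

theorem one_lt_of_one_le_sq_mul (hr0 : 0 < r) (hr1 : r < 1) {a : ℝ} (h : 1 ≤ r ^ 2 * a) :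
    1 < a := by
  have : r ^ 2 < 1 := pow_lt_one₀ hr0.le hr1 two_ne_zero
  nlinarith [pow_pos hr0 2]

theorem formal_coords_le (hna : IsNonarchimedean v) (hv2 : v 2 = 1)
    (h₂ : v b₂ ≤ 1) (h₄ : v b₄ ≤ 1) (h₆ : v b₆ ≤ 1) (hr0 : 0 < r) (hr1 : r < 1) {x u : F}
    (hu : u ^ 2 = 4 * x ^ 3 + b₂ * x ^ 2 + 2 * b₄ * x + b₆) (hx : 1 ≤ r ^ 2 * v x) :
    u ≠ 0 ∧ v (x / u) ≤ r ∧ v (1 / u) ≤ r ^ 3 := by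
  have hx1 : 1 < v x := one_lt_of_one_le_sq_mul hr0 hr1 hx
  have h := abv_cubic hna hv2 h₂ h₄ h₆ hx1
  rw [← hu, v.map_pow] at h
  have hu0 : u ≠ 0 := by
    rintro rfl
    rw [map_zero] at h
    have : 0 < v x ^ 3 := by positivity
    linarith
  have hvu : 0 < v u := v.pos hu0
  refine ⟨hu0, ?_, ?_⟩
  · rw [map_div₀, div_le_iff₀ hvu]
    refine le_of_sq_le_sq ?_ (by positivity)
    rw [mul_pow, h]
    nlinarith [pow_pos (one_pos.trans hx1) 2]
  · rw [map_div₀, map_one, div_le_iff₀ hvu]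
    refine le_of_sq_le_sq ?_ (by positivity)
    calc (1 : ℝ) ^ 2 = 1 ^ 3 := by norm_num
      _ ≤ (r ^ 2 * v x) ^ 3 := by gcongr
      _ = (r ^ 3 * v u) ^ 2 := by rw [mul_pow, mul_pow _ (v u), h]; ring

theorem secant_slope_le (hna : IsNonarchimedean v) (hv2 : v 2 = 1)
    (h₂ : v b₂ ≤ 1) (h₄ : v b₄ ≤ 1) (h₆ : v b₆ ≤ 1) (hr0 : 0 < r) (hr1 : r < 1)
    {x₁ u₁ x₂ u₂ L M : F}
    (hu₁ : u₁ ^ 2 = 4 * x₁ ^ 3 + b₂ * x₁ ^ 2 + 2 * b₄ * x₁ + b₆) (hx₁ : 1 ≤ r ^ 2 * v x₁)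
    (hu₂ : u₂ ^ 2 = 4 * x₂ ^ 3 + b₂ * x₂ ^ 2 + 2 * b₄ * x₂ + b₆) (hx₂ : 1 ≤ r ^ 2 * v x₂)
    (hl₁ : u₁ = L * x₁ + M) (hl₂ : u₂ = L * x₂ + M) (hne : x₁ ≠ x₂) : v L ≤ r ^ 2 * v M := by
  obtain ⟨hu₁0, ht₁, hw₁⟩ := formal_coords_le hna hv2 h₂ h₄ h₆ hr0 hr1 hu₁ hx₁
  obtain ⟨hu₂0, ht₂, hw₂⟩ := formal_coords_le hna hv2 h₂ h₄ h₆ hr0 hr1 hu₂ hx₂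
  obtain ⟨t₁, ht₁'⟩ : ∃ t, t = x₁ / u₁ := ⟨_, rfl⟩
  obtain ⟨t₂, ht₂'⟩ : ∃ t, t = x₂ / u₂ := ⟨_, rfl⟩
  obtain ⟨w₁, hw₁'⟩ : ∃ t, t = 1 / u₁ := ⟨_, rfl⟩
  obtain ⟨w₂, hw₂'⟩ : ∃ t, t = 1 / u₂ := ⟨_, rfl⟩
  have hc₁ : w₁ = 4 * t₁ ^ 3 + b₂ * t₁ ^ 2 * w₁ + 2 * b₄ * t₁ * w₁ ^ 2 + b₆ * w₁ ^ 3 := by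
    rw [ht₁', hw₁']; field_simp; linear_combination hu₁
  have hc₂ : w₂ = 4 * t₂ ^ 3 + b₂ * t₂ ^ 2 * w₂ + 2 * b₄ * t₂ * w₂ ^ 2 + b₆ * w₂ ^ 3 := by
    rw [ht₂', hw₂']; field_simp; linear_combination hu₂
  have hd₁ : L * t₁ + M * w₁ = 1 := by
    rw [ht₁', hw₁']; field_simp; exact hl₁.symm
  have hd₂ : L * t₂ + M * w₂ = 1 := by
    rw [ht₂', hw₂']; field_simp; exact hl₂.symm
  have hne' : ¬ (t₁ = t₂ ∧ w₁ = w₂) := by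
    rintro ⟨ht, hw⟩
    apply hne
    rw [hw₁', hw₂', one_div, one_div, inv_inj] at hw
    rw [ht₁', ht₂', hw] at ht
    exact (div_left_inj' hu₂0).mp ht
  rw [← ht₁'] at ht₁
  rw [← ht₂'] at ht₂
  rw [← hw₁'] at hw₁
  rw [← hw₂'] at hw₂
  clear ht₁' ht₂' hw₁' hw₂'
  have hr2 : r ^ 2 < 1 := pow_lt_one₀ hr0.le hr1 two_ne_zero
  have hr32 : r ^ 3 ≤ r ^ 2 := pow_le_pow_of_le_one hr0.le hr1.le (by norm_num)
  have hw₁r : v w₁ ≤ r := hw₁.trans (pow_le_of_le_one hr0.le hr1.le (by norm_num))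
  have hw₂r : v w₂ ≤ r := hw₂.trans (pow_le_of_le_one hr0.le hr1.le (by norm_num))
  have hq : ∀ {a b : F}, v a ≤ r → v b ≤ r → v (a * b) ≤ r ^ 2 := fun ha hb => by
    rw [pow_two]; exact mul_le_of_le ha hb
  have h2 : v (2 : F) ≤ 1 := ofNat_le_one hna 2
  set U : F := 1 + -(b₂ * (t₁ * t₁) + 2 * b₄ * (t₁ * (w₁ + w₂))
    + b₆ * (w₁ * w₁ + w₁ * w₂ + w₂ * w₂)) with hU
  set S : F := 4 * (t₁ * t₁ + t₁ * t₂ + t₂ * t₂) + b₂ * ((t₁ + t₂) * w₂)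
    + 2 * b₄ * (w₂ * w₂) with hS
  have hUS : (w₁ - w₂) * U = (t₁ - t₂) * S := by
    rw [hU, hS]; linear_combination hc₁ - hc₂
  have hSle : v S ≤ r ^ 2 := by
    refine add_le_of_le hna (add_le_of_le hna ?_ ?_) ?_
    · exact int_mul_le (ofNat_le_one hna 4)
        (add_le_of_le hna (add_le_of_le hna (hq ht₁ ht₁) (hq ht₁ ht₂)) (hq ht₂ ht₂))
    · exact int_mul_le h₂ (hq (add_le_of_le hna ht₁ ht₂) hw₂r)
    · exact int_mul_le (int_mul_le h2 h₄) (hq hw₂r hw₂r)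
  have hU1 : v U = 1 := by
    rw [hU, add_eq_of_lt hna, v.map_one]
    rw [v.map_neg, v.map_one]
    refine lt_of_le_of_lt (add_le_of_le hna (add_le_of_le hna ?_ ?_) ?_) hr2
    · exact int_mul_le h₂ (hq ht₁ ht₁)
    · exact int_mul_le (int_mul_le h2 h₄) (hq ht₁ (add_le_of_le hna hw₁r hw₂r))
    · exact int_mul_le h₆
        (add_le_of_le hna (add_le_of_le hna (hq hw₁r hw₁r) (hq hw₁r hw₂r)) (hq hw₂r hw₂r))
  have hU0 : U ≠ 0 := by
    intro h; rw [h, map_zero] at hU1; exact zero_ne_one hU1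
  have htne : t₁ - t₂ ≠ 0 := by
    intro h
    rw [h, zero_mul] at hUS
    exact hne' ⟨sub_eq_zero.mp h, sub_eq_zero.mp ((mul_eq_zero.mp hUS).resolve_right hU0)⟩
  have hLM : L * U = -(S * M) := by
    apply mul_left_cancel₀ htne
    linear_combination U * (hd₁ - hd₂) - M * hUS
  have := congrArg v hLM
  rw [v.map_mul, v.map_neg, v.map_mul, hU1, mul_one] at this
  rw [this]
  exact mul_le_mul_of_nonneg_right hSle (v.nonneg _)

theorem tangent_slope_le (hna : IsNonarchimedean v) (hv2 : v 2 = 1)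
    (h₂ : v b₂ ≤ 1) (h₄ : v b₄ ≤ 1) (h₆ : v b₆ ≤ 1) (hr0 : 0 < r) (hr1 : r < 1)
    {x u L M : F} (hu0 : u ≠ 0) (hx : 1 ≤ r ^ 2 * v x)
    (hL : L * u = 6 * x ^ 2 + b₂ * x + b₄) (hM : M * u = -2 * x ^ 3 + b₄ * x + b₆) :
    v L ≤ r ^ 2 * v M := by
  have hx1 : 1 < v x := one_lt_of_one_le_sq_mul hr0 hr1 hx
  have hxx : v x ≤ v x ^ 2 := by nlinarith
  have hLe : v (6 * x ^ 2 + b₂ * x + b₄) ≤ v x ^ 2 := by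
    refine add_le_of_le hna (add_le_of_le hna ?_ ?_) ?_
    · exact int_mul_le (ofNat_le_one hna 6) (v.map_pow x 2).le
    · exact (int_mul_le h₂ le_rfl).trans hxx
    · exact h₄.trans (hx1.le.trans hxx)
  have hMe : v (-2 * x ^ 3 + b₄ * x + b₆) = v x ^ 3 := by
    have h2x : v (-2 * x ^ 3) = v x ^ 3 := by
      rw [v.map_mul, v.map_neg, hv2, v.map_pow, one_mul]
    rw [add_assoc, add_eq_of_lt hna, h2x]
    rw [h2x]
    refine lt_of_le_of_lt (b := v x) (add_le_of_le hna (int_mul_le h₄ le_rfl) (h₆.trans hx1.le)) ?_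
    exact lt_self_pow₀ hx1 (by norm_num)
  have hvu : 0 < v u := v.pos hu0
  refine le_of_mul_le_mul_right ?_ hvu
  rw [mul_assoc, ← v.map_mul, ← v.map_mul, hL, hM, hMe]
  nlinarith [pow_pos (one_pos.trans hx1) 2]

theorem third_point_bounds (hna : IsNonarchimedean v) (hv2 : v 2 = 1)
    (h₂ : v b₂ ≤ 1) (h₄ : v b₄ ≤ 1) (h₆ : v b₆ ≤ 1) (hr0 : 0 < r) (hr1 : r < 1)
    {x₁ u₁ x₂ u₂ x₃ u₃ L M : F}
    (hu₁ : u₁ ^ 2 = 4 * x₁ ^ 3 + b₂ * x₁ ^ 2 + 2 * b₄ * x₁ + b₆) (hx₁ : 1 ≤ r ^ 2 * v x₁)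
    (hu₂ : u₂ ^ 2 = 4 * x₂ ^ 3 + b₂ * x₂ ^ 2 + 2 * b₄ * x₂ + b₆) (hx₂ : 1 ≤ r ^ 2 * v x₂)
    (hu₃ : u₃ ^ 2 = 4 * x₃ ^ 3 + b₂ * x₃ ^ 2 + 2 * b₄ * x₃ + b₆)
    (hl₁ : u₁ = L * x₁ + M) (hl₂ : u₂ = L * x₂ + M) (hl₃ : u₃ = -(L * x₃ + M))
    (he₁ : 4 * (x₁ + x₂ + x₃) = L ^ 2 - b₂)
    (he₂ : 2 * (x₁ * x₂ + x₁ * x₃ + x₂ * x₃) = b₄ - L * M)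
    (he₃ : 4 * (x₁ * x₂ * x₃) = M ^ 2 - b₆)
    (hL : v L ≤ r ^ 2 * v M) :
    1 ≤ r ^ 2 * v x₃ ∧ v (x₃ / u₃ - (x₁ / u₁ + x₂ / u₂)) ≤ r ^ 3 := by
  obtain ⟨hu₁0, ht₁, hw₁⟩ := formal_coords_le hna hv2 h₂ h₄ h₆ hr0 hr1 hu₁ hx₁
  obtain ⟨hu₂0, ht₂, hw₂⟩ := formal_coords_le hna hv2 h₂ h₄ h₆ hr0 hr1 hu₂ hx₂
  have hr2 : r ^ 2 < 1 := pow_lt_one₀ hr0.le hr1 two_ne_zero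
  have hM1 : 1 ≤ r ^ 3 * v M := by
    have hd₁ : L * (x₁ / u₁) + M * (1 / u₁) = 1 := by field_simp; exact hl₁.symm
    calc 1 = v (L * (x₁ / u₁) + M * (1 / u₁)) := by rw [hd₁, v.map_one]
      _ ≤ r ^ 3 * v M := by
        refine add_le_of_le hna ((mul_le_of_le hL ht₁).trans_eq (by ring))
          ((mul_le_of_le le_rfl hw₁).trans_eq (by ring))
  have hMpos : 0 < v M := by
    by_contra h
    have : v M = 0 := le_antisymm (not_lt.mp h) (v.nonneg _)
    rw [this] at hM1
    norm_num at hM1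
  have hLM : v L < v M := by nlinarith
  have hLM' : v L ≤ v M := hLM.le
  have hv4 : v (4 : F) = 1 := by
    rw [show (4 : F) = 2 * 2 by norm_num, v.map_mul, hv2, one_mul]
  have hd : 4 * (u₁ * u₂ * u₃) =
      -(4 * M ^ 3 + L * (-b₆ * (L * L) + 2 * b₄ * (L * M) + -b₂ * (M * M))) := by
    rw [hl₁, hl₂, hl₃]
    linear_combination -L ^ 3 * he₃ - 2 * L ^ 2 * M * he₂ - L * M ^ 2 * he₁
  have hvd : v (u₁ * u₂ * u₃) = v M ^ 3 := by
    have h4 : v (4 * M ^ 3) = v M ^ 3 := by rw [v.map_mul, hv4, one_mul, v.map_pow]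
    rw [← one_mul (v (u₁ * u₂ * u₃)), ← hv4, ← v.map_mul, hd, v.map_neg, add_eq_of_lt hna, h4]
    rw [h4]
    calc v (L * (-b₆ * (L * L) + 2 * b₄ * (L * M) + -b₂ * (M * M))) ≤ v L * (v M * v M) := by
          refine mul_le_of_le le_rfl (add_le_of_le hna (add_le_of_le hna ?_ ?_) ?_)
          · exact int_mul_le (by rwa [v.map_neg]) (mul_le_of_le hLM' hLM')
          · exact int_mul_le (int_mul_le (ofNat_le_one hna 2) h₄) (mul_le_of_le hLM' le_rfl)
          · exact int_mul_le (by rwa [v.map_neg]) (mul_le_of_le le_rfl le_rfl)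
      _ < v M * (v M * v M) := by gcongr
      _ = v M ^ 3 := by ring
  have hu₃0 : u₃ ≠ 0 := by
    rintro rfl
    rw [mul_zero, map_zero] at hvd
    exact (pow_pos hMpos 3).ne hvd
  have hn : 4 * (x₃ * (u₁ * u₂) - x₁ * u₂ * u₃ - x₂ * u₁ * u₃) =
      -3 * b₆ * (L * L) + 4 * b₄ * (L * M) + -b₂ * (M * M) := by
    rw [hl₁, hl₂, hl₃]
    linear_combination 3 * L ^ 2 * he₃ + 4 * L * M * he₂ + M ^ 2 * he₁
  have hvn : v (x₃ * (u₁ * u₂) - x₁ * u₂ * u₃ - x₂ * u₁ * u₃) ≤ v M * v M := by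
    rw [← one_mul (v (x₃ * (u₁ * u₂) - x₁ * u₂ * u₃ - x₂ * u₁ * u₃)), ← hv4, ← v.map_mul, hn]
    refine add_le_of_le hna (add_le_of_le hna ?_ ?_) ?_
    · exact int_mul_le (int_mul_le (by rw [v.map_neg]; exact ofNat_le_one hna 3) h₆)
        (mul_le_of_le hLM' hLM')
    · exact int_mul_le (int_mul_le (ofNat_le_one hna 4) h₄) (mul_le_of_le hLM' le_rfl)
    · exact int_mul_le (by rwa [v.map_neg]) (mul_le_of_le le_rfl le_rfl)
  have hsum : v (x₃ / u₃ - (x₁ / u₁ + x₂ / u₂)) ≤ r ^ 3 := by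
    rw [show x₃ / u₃ - (x₁ / u₁ + x₂ / u₂) =
      (x₃ * (u₁ * u₂) - x₁ * u₂ * u₃ - x₂ * u₁ * u₃) / (u₁ * u₂ * u₃) by field_simp; ring,
      map_div₀, hvd, div_le_iff₀ (by positivity)]
    calc _ ≤ v M * v M := hvn
      _ = 1 * (v M * v M) := by ring
      _ ≤ (r ^ 3 * v M) * (v M * v M) := by gcongr
      _ = r ^ 3 * v M ^ 3 := by ring
  refine ⟨?_, hsum⟩
  have hr3 : r ^ 3 ≤ r := pow_le_of_le_one hr0.le hr1.le (by norm_num)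
  have ht₃ : v (x₃ / u₃) ≤ r := by
    rw [← sub_add_cancel (x₃ / u₃) (x₁ / u₁ + x₂ / u₂)]
    exact add_le_of_le hna (hsum.trans hr3) (add_le_of_le hna ht₁ ht₂)
  have hu₃1 : 1 ≤ r ^ 3 * v u₃ := by
    have hd₃ : M = -(1 + L * (x₃ / u₃)) * u₃ := by field_simp; linear_combination hl₃
    have hle : v (1 + L * (x₃ / u₃)) ≤ r ^ 3 * v M :=
      add_le_of_le hna (by rwa [v.map_one])
        ((mul_le_of_le hL ht₃).trans_eq (by ring))
    have := congrArg v hd₃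
    rw [v.map_mul, v.map_neg] at this
    refine le_of_mul_le_mul_left ?_ hMpos
    calc v M * 1 = v (1 + L * (x₃ / u₃)) * v u₃ := by rw [mul_one, this]
      _ ≤ r ^ 3 * v M * v u₃ := mul_le_mul_of_nonneg_right hle (v.nonneg _)
      _ = v M * (r ^ 3 * v u₃) := by ring
  have hu₃sq : 1 ≤ r ^ 6 * v u₃ ^ 2 := by
    calc (1 : ℝ) ≤ (r ^ 3 * v u₃) ^ 2 := one_le_pow₀ hu₃1
      _ = _ := by ring
  have hx₃1 : 1 < v x₃ := by
    by_contra! h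
    have h1 : v (u₃ ^ 2) ≤ 1 := by
      rw [hu₃]
      refine add_le_of_le hna (add_le_of_le hna (add_le_of_le hna ?_ ?_) ?_) h₆
      · exact int_mul_le hv4.le (by rw [v.map_pow]; exact pow_le_one₀ (v.nonneg _) h)
      · exact int_mul_le h₂ (by rw [v.map_pow]; exact pow_le_one₀ (v.nonneg _) h)
      · exact int_mul_le (int_mul_le hv2.le h₄) h
    rw [v.map_pow] at h1
    have h6 : r ^ 6 < 1 := pow_lt_one₀ hr0.le hr1 (by norm_num)
    nlinarith [pow_pos hr0 6]
  have h3 := abv_cubic hna hv2 h₂ h₄ h₆ hx₃1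
  rw [← hu₃, v.map_pow] at h3
  rw [h3] at hu₃sq
  by_contra! h
  have : (r ^ 2 * v x₃) ^ 3 < 1 := pow_lt_one₀ (by positivity) h (by norm_num)
  nlinarith

end Cubic

namespace WeierstrassCurve.Affine

open AbsoluteValue

variable {F : Type*} [Field F] {v : AbsoluteValue F ℝ} {W : WeierstrassCurve.Affine F} {r : ℝ}

theorem sq_of_equation {x y : F} (h : W.Equation x y) :
    (2 * y + W.a₁ * x + W.a₃) ^ 2 = 4 * x ^ 3 + W.b₂ * x ^ 2 + 2 * W.b₄ * x + W.b₆ := by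
  rw [equation_iff] at h
  simp only [WeierstrassCurve.b₂, WeierstrassCurve.b₄, WeierstrassCurve.b₆]
  linear_combination 4 * h

/-- The coefficients of `W` are integral with respect to `v`. -/
structure IsIntegralAt (v : AbsoluteValue F ℝ) (W : WeierstrassCurve.Affine F) : Prop where
  a₁ : v W.a₁ ≤ 1
  a₂ : v W.a₂ ≤ 1
  a₃ : v W.a₃ ≤ 1
  a₄ : v W.a₄ ≤ 1
  a₆ : v W.a₆ ≤ 1

namespace IsIntegralAt

variable (hW : W.IsIntegralAt v) (hna : IsNonarchimedean v)
include hW hna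

theorem b₂ : v W.b₂ ≤ 1 :=
  add_le_of_le hna (by rw [v.map_pow]; exact pow_le_one₀ (v.nonneg _) hW.a₁)
    (int_mul_le (ofNat_le_one hna 4) hW.a₂)

theorem b₄ : v W.b₄ ≤ 1 :=
  add_le_of_le hna (int_mul_le (ofNat_le_one hna 2) hW.a₄) (int_mul_le hW.a₁ hW.a₃)

theorem b₆ : v W.b₆ ≤ 1 :=
  add_le_of_le hna (by rw [v.map_pow]; exact pow_le_one₀ (v.nonneg _) hW.a₃)
    (int_mul_le (ofNat_le_one hna 4) hW.a₆)

theorem y_le_one {x y : F} (h : W.Equation x y) (hx : v x ≤ 1) : v y ≤ 1 := by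
  by_contra! hy
  rw [equation_iff] at h
  have hp : ∀ n, v (x ^ n) ≤ 1 := fun n => by
    rw [v.map_pow]; exact pow_le_one₀ (v.nonneg _) hx
  have h1 : v (x ^ 3 + W.a₂ * x ^ 2 + W.a₄ * x + W.a₆ - (W.a₁ * x + W.a₃) * y) ≤ v y := by
    refine sub_le_of_le hna (le_trans ?_ hy.le)
      (int_mul_le (add_le_of_le hna (int_mul_le hW.a₁ hx) hW.a₃) le_rfl)
    exact add_le_of_le hna (add_le_of_le hna (add_le_of_le hna (hp 3) (int_mul_le hW.a₂ (hp 2)))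
      (int_mul_le hW.a₄ hx)) hW.a₆
  rw [show x ^ 3 + W.a₂ * x ^ 2 + W.a₄ * x + W.a₆ - (W.a₁ * x + W.a₃) * y = y ^ 2 by
    linear_combination -h, v.map_pow] at h1
  nlinarith

end IsIntegralAt

/-- The parameter `-2t` at infinity, where `t = -x / (y + (a₁x + a₃) / 2)`. -/
def formalParam : W.Point → F
  | .zero => 0
  | .some x y _ => x / (2 * y + W.a₁ * x + W.a₃)

/-- The points whose distance to infinity is at most `r`, with respect to `v`. -/
def NearZero (v : AbsoluteValue F ℝ) (r : ℝ) : W.Point → Prop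
  | .zero => True
  | .some x _ _ => 1 ≤ r ^ 2 * v x

theorem nearZero_zero : NearZero v r (0 : W.Point) := trivial

theorem formalParam_zero : formalParam (0 : W.Point) = 0 := rfl

theorem formalParam_neg (P : W.Point) : formalParam (-P) = -formalParam P := by
  rcases P with _ | ⟨x, y, h⟩
  · exact neg_zero.symm
  · change x / (2 * (-y - W.a₁ * x - W.a₃) + W.a₁ * x + W.a₃) = -(x / (2 * y + W.a₁ * x + W.a₃))
    rw [← div_neg]
    congr 1
    ring

theorem vieta_addX [DecidableEq F] {x₁ x₂ y₁ y₂ : F} (h₁ : W.Equation x₁ y₁)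
    (h₂ : W.Equation x₂ y₂) (hxy : ¬(x₁ = x₂ ∧ y₁ = W.negY x₂ y₂)) {ℓ x₃ : F}
    (hℓ : ℓ = W.slope x₁ x₂ y₁ y₂) (hx₃ : x₃ = W.addX x₁ x₂ ℓ) :
    x₁ * x₂ + x₁ * x₃ + x₂ * x₃ =
      2 * x₁ * ℓ ^ 2 + (W.a₁ * x₁ - 2 * y₁ - W.a₃) * ℓ + (-W.a₁ * y₁ + W.a₄) ∧
    x₁ * x₂ * x₃ = x₁ ^ 2 * ℓ ^ 2 - (2 * x₁ * y₁ + W.a₃ * x₁) * ℓ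
      + (y₁ ^ 2 + W.a₃ * y₁ - W.a₆) := by
  have h := addPolynomial_slope h₁ h₂ hxy
  rw [← hℓ, ← hx₃, addPolynomial_eq, neg_inj] at h
  rw [Cubic.prod_X_sub_C_eq] at h
  obtain ⟨-, -, hc, hd⟩ := Cubic.mk.inj ((Cubic.toPoly_injective _ _).mp h)
  constructor
  · linear_combination -hc
  · linear_combination hd

variable [DecidableEq F]

theorem nearZero_add_aux (hna : IsNonarchimedean v) (hv2 : v 2 = 1) (hW : W.IsIntegralAt v)
    (hr0 : 0 < r) (hr1 : r < 1) {P Q : W.Point} (hP : NearZero v r P) (hQ : NearZero v r Q) :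
    NearZero v r (P + Q) ∧
      v (formalParam (P + Q) - (formalParam P + formalParam Q)) ≤ r ^ 3 := by
  have hr3 : 0 ≤ r ^ 3 := by positivity
  rcases P with _ | ⟨x₁, y₁, h₁⟩
  · rw [← Point.zero_def, zero_add, formalParam_zero, zero_add, sub_self, map_zero]
    exact ⟨hQ, hr3⟩
  rcases Q with _ | ⟨x₂, y₂, h₂⟩
  · rw [← Point.zero_def, add_zero, formalParam_zero, add_zero, sub_self, map_zero]
    exact ⟨hP, hr3⟩
  by_cases hxy : x₁ = x₂ ∧ y₁ = W.negY x₂ y₂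
  · have hneg : Point.some x₁ y₁ h₁ = -Point.some x₂ y₂ h₂ := by
      rw [Point.neg_some]; simp [hxy]
    rw [hneg, neg_add_cancel, formalParam_neg, neg_add_cancel, formalParam_zero, sub_self, map_zero]
    exact ⟨nearZero_zero, hr3⟩
  rw [Point.add_some hxy]
  have hq₁ := sq_of_equation h₁.1
  have hq₂ := sq_of_equation h₂.1
  have hq₃ := sq_of_equation (nonsingular_add h₁ h₂ hxy).1
  change 1 ≤ r ^ 2 * v x₁ at hP
  change 1 ≤ r ^ 2 * v x₂ at hQ
  have hb₂ := hW.b₂ hna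
  have hb₄ := hW.b₄ hna
  have hb₆ := hW.b₆ hna
  obtain ⟨ℓ, hℓ⟩ : ∃ ℓ, ℓ = W.slope x₁ x₂ y₁ y₂ := ⟨_, rfl⟩
  obtain ⟨x₃, hx₃⟩ : ∃ x₃, x₃ = W.addX x₁ x₂ ℓ := ⟨_, rfl⟩
  obtain ⟨y₃, hy₃⟩ : ∃ y₃, y₃ = W.addY x₁ x₂ y₁ ℓ := ⟨_, rfl⟩
  obtain ⟨hv₂, hv₃⟩ := vieta_addX h₁.1 h₂.1 hxy hℓ hx₃
  change 1 ≤ r ^ 2 * v (W.addX x₁ x₂ (W.slope x₁ x₂ y₁ y₂)) ∧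
    v (W.addX x₁ x₂ (W.slope x₁ x₂ y₁ y₂) / (2 * W.addY x₁ x₂ y₁ (W.slope x₁ x₂ y₁ y₂)
      + W.a₁ * W.addX x₁ x₂ (W.slope x₁ x₂ y₁ y₂) + W.a₃) -
      (x₁ / (2 * y₁ + W.a₁ * x₁ + W.a₃) + x₂ / (2 * y₂ + W.a₁ * x₂ + W.a₃))) ≤ r ^ 3
  rw [← hℓ, ← hx₃, ← hy₃] at hq₃ ⊢
  have hx₃' : x₃ = ℓ ^ 2 + W.a₁ * ℓ - W.a₂ - x₁ - x₂ := hx₃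
  have hy₃' : y₃ = -(ℓ * (x₃ - x₁) + y₁) - W.a₁ * x₃ - W.a₃ := by rw [hy₃, hx₃]; rfl
  have hline : y₂ = ℓ * (x₂ - x₁) + y₁ := by
    by_cases hx : x₁ = x₂
    · rw [hx, sub_self, mul_zero, zero_add]
      exact (Y_eq_of_Y_ne h₁.1 h₂.1 hx fun h => hxy ⟨hx, h⟩).symm
    · rw [hℓ, slope_of_X_ne hx]
      field_simp [sub_ne_zero.mpr hx]
      ring
  have h20 : (2 : F) ≠ 0 := v.ne_zero_iff.mp (by rw [hv2]; exact one_ne_zero)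
  obtain ⟨hu₁0, -, -⟩ := formal_coords_le hna hv2 hb₂ hb₄ hb₆ hr0 hr1 hq₁ hP
  refine third_point_bounds (L := 2 * ℓ + W.a₁) (M := 2 * (y₁ - ℓ * x₁) + W.a₃)
    hna hv2 hb₂ hb₄ hb₆ hr0 hr1 hq₁ hP hq₂ hQ hq₃ (by ring) (by rw [hline]; ring)
    (by rw [hy₃']; ring) ?_ ?_ ?_ ?_
  · rw [hx₃', WeierstrassCurve.b₂]; ring
  · rw [hv₂, WeierstrassCurve.b₄]; ring
  · rw [hv₃, WeierstrassCurve.b₆]; ring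
  · by_cases hx : x₁ = x₂
    · have hyn : y₁ ≠ W.negY x₂ y₂ := fun h => hxy ⟨hx, h⟩
      have hy := Y_eq_of_Y_ne h₁.1 h₂.1 hx hyn
      subst hx hy
      have hsl : ℓ * (2 * y₁ + W.a₁ * x₁ + W.a₃) =
          3 * x₁ ^ 2 + 2 * W.a₂ * x₁ + W.a₄ - W.a₁ * y₁ := by
        rw [hℓ, slope_of_Y_ne rfl hyn, negY, div_mul_eq_mul_div, div_eq_iff]
        · ring
        · convert hu₁0 using 1; ring
      refine tangent_slope_le hna hv2 hb₂ hb₄ hb₆ hr0 hr1 hu₁0 hP ?_ ?_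
      · rw [WeierstrassCurve.b₂, WeierstrassCurve.b₄]
        linear_combination 2 * hsl
      · rw [WeierstrassCurve.b₂, WeierstrassCurve.b₄, WeierstrassCurve.b₆] at hq₁
        rw [WeierstrassCurve.b₄, WeierstrassCurve.b₆]
        linear_combination hq₁ - 2 * x₁ * hsl
    · exact secant_slope_le hna hv2 hb₂ hb₄ hb₆ hr0 hr1 hq₁ hP hq₂ hQ (by ring)
        (by rw [hline]; ring) hx

end WeierstrassCurve.Affine

namespace WeierstrassCurve.Affine

open AbsoluteValue

variable {F : Type*} [Field F] {v : AbsoluteValue F ℝ} {W : WeierstrassCurve.Affine F} {r : ℝ}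

/-- The points in the kernel of reduction with respect to `v`. -/
def ReducesToZero (v : AbsoluteValue F ℝ) : W.Point → Prop
  | .zero => True
  | .some x _ _ => 1 < v x

theorem NearZero.reducesToZero (hr0 : 0 < r) (hr1 : r < 1) {P : W.Point} (hP : NearZero v r P) :
    ReducesToZero v P := by
  rcases P with _ | ⟨x, y, h⟩
  · trivial
  · exact one_lt_of_one_le_sq_mul hr0 hr1 hP

theorem ReducesToZero.nearZero (hna : IsNonarchimedean v) (hv2 : v 2 = 1) (hW : W.IsIntegralAt v)
    {P : W.Point} (hP : ReducesToZero v P) (hP0 : P ≠ 0) :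
    0 < v (formalParam P) ∧ v (formalParam P) < 1 ∧ NearZero v (v (formalParam P)) P := by
  rcases P with _ | ⟨x, y, h⟩
  · exact absurd rfl hP0
  have hx : 1 < v x := hP
  have hu := congrArg v (sq_of_equation h.1)
  rw [v.map_pow, abv_cubic hna hv2 (hW.b₂ hna) (hW.b₄ hna) (hW.b₆ hna) hx] at hu
  have hx0 : 0 < v x := one_pos.trans hx
  have hu0 : 0 < v (2 * y + W.a₁ * x + W.a₃) := by
    refine (v.nonneg _).lt_of_ne' fun h0 => ?_
    rw [h0] at hu
    have := pow_pos hx0 3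
    linarith
  have ht : v (formalParam (Point.some x y h)) = v x / v (2 * y + W.a₁ * x + W.a₃) :=
    map_div₀ v _ _
  have hr : (v x / v (2 * y + W.a₁ * x + W.a₃)) ^ 2 * v x = 1 := by
    rw [div_pow, hu]; field_simp
  rw [ht]
  have ht0 : 0 < v x / v (2 * y + W.a₁ * x + W.a₃) := div_pos hx0 hu0
  refine ⟨ht0, ?_, hr.ge⟩
  by_contra! h1
  have := one_le_pow₀ h1 (n := 2)
  nlinarith

theorem one_lt_addX (hna : IsNonarchimedean v) (hW : W.IsIntegralAt v) {x₁ x₂ ℓ : F}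
    (hx₁ : v x₁ ≤ 1) (hx₂ : v x₂ ≤ 1) (hℓ : 1 < v ℓ) : 1 < v (W.addX x₁ x₂ ℓ) := by
  have h2 : v ℓ < v (ℓ ^ 2) := by
    rw [v.map_pow]; exact lt_self_pow₀ hℓ (by norm_num)
  have hrest : v (W.a₁ * ℓ - W.a₂ - x₁ - x₂) ≤ v ℓ :=
    sub_le_of_le hna (sub_le_of_le hna (sub_le_of_le hna (int_mul_le hW.a₁ le_rfl)
      (hW.a₂.trans hℓ.le)) (hx₁.trans hℓ.le)) (hx₂.trans hℓ.le)
  rw [addX, show ℓ ^ 2 + W.a₁ * ℓ - W.a₂ - x₁ - x₂ = ℓ ^ 2 + (W.a₁ * ℓ - W.a₂ - x₁ - x₂) by ring,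
    add_eq_of_lt hna (hrest.trans_lt h2)]
  exact hℓ.trans h2

variable [DecidableEq F]

theorem NearZero.nsmul (hna : IsNonarchimedean v) (hv2 : v 2 = 1) (hW : W.IsIntegralAt v)
    (hr0 : 0 < r) (hr1 : r < 1) {P : W.Point} (hP : NearZero v r P) (n : ℕ) :
    NearZero v r (n • P) ∧ v (formalParam (n • P) - n * formalParam P) ≤ r ^ 3 := by
  induction n with
  | zero =>
    rw [zero_nsmul, formalParam_zero, Nat.cast_zero, zero_mul, sub_zero, map_zero]
    exact ⟨nearZero_zero, by positivity⟩
  | succ n ih =>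
    obtain ⟨h, h'⟩ := nearZero_add_aux hna hv2 hW hr0 hr1 ih.1 hP
    rw [succ_nsmul]
    refine ⟨h, ?_⟩
    convert add_le_of_le hna h' ih.2 using 2
    push_cast
    ring

theorem ReducesToZero.nsmul (hna : IsNonarchimedean v) (hv2 : v 2 = 1) (hW : W.IsIntegralAt v)
    {P : W.Point} (hP : ReducesToZero v P) (n : ℕ) : ReducesToZero v (n • P) := by
  by_cases hP0 : P = 0
  · rw [hP0, nsmul_zero]; trivial
  · obtain ⟨hr0, hr1, h⟩ := hP.nearZero hna hv2 hW hP0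
    exact (h.nsmul hna hv2 hW hr0 hr1 n).1.reducesToZero hr0 hr1

/-- The kernel of reduction is torsion-free when `v` is not too ramified. -/
theorem ReducesToZero.eq_zero_of_nsmul_eq_zero (hna : IsNonarchimedean v) (hv2 : v 2 = 1)
    (hW : W.IsIntegralAt v) (hram : ∀ x, v x < 1 → ∀ ℓ : ℕ, ℓ.Prime → v x ^ 2 < v (ℓ : F))
    {n : ℕ} (hn : n ≠ 0) {P : W.Point} (hP : ReducesToZero v P) (h : n • P = 0) : P = 0 := by
  induction n using induction_on_primes generalizing P with
  | zero => exact absurd rfl hn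
  | one => rwa [one_nsmul] at h
  | prime_mul ℓ n hℓ ih =>
    rw [mul_comm, mul_nsmul] at h
    refine ih (right_ne_zero_of_mul hn) hP ?_
    by_contra hQ0
    obtain ⟨hr0, hr1, hQ⟩ := (hP.nsmul hna hv2 hW n).nearZero hna hv2 hW hQ0
    have hle := (hQ.nsmul hna hv2 hW hr0 hr1 ℓ).2
    rw [h, formalParam_zero, zero_sub, v.map_neg, v.map_mul] at hle
    have hlt := hram _ hr1 ℓ hℓ
    nlinarith

/-- The difference of two integral points with the same nonsingular reduction reduces to zero. -/
theorem reducesToZero_sub (hna : IsNonarchimedean v) (hW : W.IsIntegralAt v)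
    {x₁ y₁ x₂ y₂ : F} (h₁ : W.Nonsingular x₁ y₁) (h₂ : W.Nonsingular x₂ y₂)
    (hx₁ : v x₁ ≤ 1) (hx₂ : v x₂ ≤ 1) (hx : v (x₁ - x₂) < 1) (hy : v (y₁ - y₂) < 1)
    (hns : v (2 * y₁ + W.a₁ * x₁ + W.a₃) = 1 ∨
      v (3 * x₁ ^ 2 + 2 * W.a₂ * x₁ + W.a₄ - W.a₁ * y₁) = 1) :
    ReducesToZero v (Point.some x₁ y₁ h₁ - Point.some x₂ y₂ h₂) := by
  have hlt : ∀ {a b : F}, v a < 1 → v b < 1 → v (a + b) < 1 := fun ha hb =>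
    (hna _ _).trans_lt (max_lt ha hb)
  have hmul : ∀ {a b : F}, v a ≤ 1 → v b < 1 → v (a * b) < 1 := fun ha hb =>
    (int_mul_le ha le_rfl).trans_lt hb
  rw [sub_eq_add_neg, Point.neg_some]
  by_cases hxy : x₁ = x₂ ∧ y₁ = W.negY x₂ (W.negY x₂ y₂)
  · rw [Point.add_of_Y_eq hxy.1 hxy.2]; trivial
  rw [Point.add_some hxy]
  refine one_lt_addX hna hW hx₁ hx₂ ?_
  have hy' : y₁ - W.negY x₂ y₂ =
      2 * y₁ + W.a₁ * x₁ + W.a₃ + -(W.a₁ * (x₁ - x₂) + (y₁ - y₂)) := by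
    rw [negY]; ring
  have hsmall : v (-(W.a₁ * (x₁ - x₂) + (y₁ - y₂))) < 1 := by
    rw [v.map_neg]; exact hlt (hmul hW.a₁ hx) hy
  have hYeq : x₁ = x₂ → y₁ = W.negY x₂ y₂ := fun hx =>
    Y_eq_of_Y_ne h₁.1 ((equation_neg ..).mpr h₂.1) hx fun h => hxy ⟨hx, h⟩
  by_cases hu : v (2 * y₁ + W.a₁ * x₁ + W.a₃) = 1
  · have hvy : v (y₁ - W.negY x₂ y₂) = 1 := by
      rw [hy', add_eq_of_lt hna (by rwa [hu]), hu]
    have hne : x₁ ≠ x₂ := fun h => by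
      rw [← hYeq h, sub_self, map_zero] at hvy
      exact zero_ne_one hvy
    rw [slope_of_X_ne hne, map_div₀, hvy]
    exact (one_lt_div (v.pos (sub_ne_zero.mpr hne))).mpr hx
  have hG0 := hns.resolve_left hu
  have hu1 : v (2 * y₁ + W.a₁ * x₁ + W.a₃) < 1 := by
    refine lt_of_le_of_ne (add_le_of_le hna (add_le_of_le hna ?_ ?_) hW.a₃) hu
    · exact int_mul_le (ofNat_le_one hna 2) (hW.y_le_one hna h₁.1 hx₁)
    · exact int_mul_le hW.a₁ hx₁
  have hvy : v (y₁ - W.negY x₂ y₂) < 1 := by rw [hy']; exact hlt hu1 hsmall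
  have hG : v (x₁ ^ 2 + x₁ * x₂ + x₂ ^ 2 + W.a₂ * (x₁ + x₂) + W.a₄ - W.a₁ * W.negY x₂ y₂) = 1 := by
    rw [show x₁ ^ 2 + x₁ * x₂ + x₂ ^ 2 + W.a₂ * (x₁ + x₂) + W.a₄ - W.a₁ * W.negY x₂ y₂ =
      (3 * x₁ ^ 2 + 2 * W.a₂ * x₁ + W.a₄ - W.a₁ * y₁) +
        (-(2 * x₁ + x₂ + W.a₂) * (x₁ - x₂) + W.a₁ * (y₁ - W.negY x₂ y₂)) by ring,
      add_eq_of_lt hna, hG0]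
    rw [hG0]
    refine hlt (hmul ?_ hx) (hmul hW.a₁ hvy)
    rw [v.map_neg]
    exact add_le_of_le hna (add_le_of_le hna (int_mul_le (ofNat_le_one hna 2) hx₁) hx₂) hW.a₂
  have hprod : W.slope x₁ x₂ y₁ (W.negY x₂ y₂) * -(-(W.a₁ * (x₁ - x₂) + (y₁ - y₂))) =
      x₁ ^ 2 + x₁ * x₂ + x₂ ^ 2 + W.a₂ * (x₁ + x₂) + W.a₄ - W.a₁ * W.negY x₂ y₂ := by
    by_cases hxe : x₁ = x₂
    · have hye := hYeq hxe
      rw [slope_of_Y_ne hxe fun h => hxy ⟨hxe, h⟩]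
      have hyn : y₁ ≠ y₂ := fun h => hxy ⟨hxe, by rw [h, negY_negY]⟩
      have hd : y₁ - W.negY x₁ y₁ = y₁ - y₂ := by
        conv_lhs => rw [hxe, hye, negY_negY]
        rw [hye]
      rw [hd, ← hye, hxe]
      field_simp [sub_ne_zero.mpr hyn]
      ring
    · have e₁ := (equation_iff ..).mp h₁.1
      have e₂ := (equation_iff ..).mp h₂.1
      rw [slope_of_X_ne hxe]
      field_simp [sub_ne_zero.mpr hxe]
      rw [negY]
      linear_combination e₁ - e₂
  have hv := congrArg v hprod
  rw [hG, v.map_mul, v.map_neg] at hv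
  by_contra! hle
  have := mul_le_mul hle hsmall.le (v.nonneg _) zero_le_one
  nlinarith [v.nonneg (-(W.a₁ * (x₁ - x₂) + (y₁ - y₂))),
    v.nonneg (W.slope x₁ x₂ y₁ (W.negY x₂ y₂))]

end WeierstrassCurve.Affine

namespace WeierstrassCurve.Affine

open AbsoluteValue

section Padic

variable {F : Type*} [Field F] {p : ℕ} [Fact p.Prime] (φ : F →+* ℚ_[p])

theorem isNonarchimedean_place : IsNonarchimedean (NumberField.place φ) := fun x y => by
  simp only [NumberField.place_apply, map_add]
  exact Padic.nonarchimedean _ _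

theorem place_two (hp : p ≠ 2) : NumberField.place φ 2 = 1 := by
  rw [NumberField.place_apply, map_ofNat]
  exact (Padic.norm_natCast_eq_one_iff (n := 2)).mpr
    ((Nat.coprime_primes Fact.out Nat.prime_two).mpr hp)

theorem place_sq_lt_natCast (x : F) (hx : NumberField.place φ x < 1) (ℓ : ℕ) (hℓ : ℓ.Prime) :
    NumberField.place φ x ^ 2 < NumberField.place φ (ℓ : F) := by
  have hx' : NumberField.place φ x ≤ (p : ℝ)⁻¹ := by
    have := (Padic.norm_le_pow_iff_norm_lt_pow_add_one (φ x) (-1)).mpr (by simpa using hx)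
    simpa using this
  have hp1 : (1 : ℝ) < p := mod_cast (Fact.out : p.Prime).one_lt
  have hinv : (p : ℝ)⁻¹ < 1 := inv_lt_one_of_one_lt₀ hp1
  have hpos : 0 < (p : ℝ)⁻¹ := by positivity
  have h2 : NumberField.place φ x ^ 2 ≤ (p : ℝ)⁻¹ ^ 2 :=
    pow_le_pow_left₀ (AbsoluteValue.nonneg _ _) hx' 2
  have h3 : (p : ℝ)⁻¹ ≤ NumberField.place φ (ℓ : F) := by
    rw [NumberField.place_apply, map_natCast]
    by_cases h : p = ℓ
    · rw [← h, Padic.norm_p]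
    · rw [Padic.norm_natCast_eq_one_iff.mpr ((Nat.coprime_primes Fact.out hℓ).mpr h)]
      exact hinv.le
  nlinarith

theorem _root_.PadicInt.norm_lt_one_iff_toZMod_eq_zero (z : ℤ_[p]) :
    ‖z‖ < 1 ↔ PadicInt.toZMod z = 0 := by
  rw [← RingHom.mem_ker, PadicInt.ker_toZMod, IsLocalRing.mem_maximalIdeal, PadicInt.mem_nonunits]

variable {φ} {W : WeierstrassCurve.Affine F}

variable (φ) in
/-- Reduction of points modulo `p`, with `none` as the point at infinity. -/
noncomputable def reduce : W.Point → Option (ZMod p × ZMod p)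
  | .zero => none
  | .some x y _ => open Classical in
    if h : ‖φ x‖ ≤ 1 ∧ ‖φ y‖ ≤ 1 then
      some (PadicInt.toZMod ⟨φ x, h.1⟩, PadicInt.toZMod ⟨φ y, h.2⟩) else none

theorem reduce_some {x y : F} (h : W.Nonsingular x y) {X Y : ℤ_[p]} (hX : φ x = X) (hY : φ y = Y) :
    reduce φ (Point.some x y h) = some (PadicInt.toZMod X, PadicInt.toZMod Y) := by
  have h1 : ‖φ x‖ ≤ 1 := hX ▸ X.norm_le_one
  have h2 : ‖φ y‖ ≤ 1 := hY ▸ Y.norm_le_one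
  rw [reduce, dif_pos ⟨h1, h2⟩]
  have hX' : (⟨φ x, h1⟩ : ℤ_[p]) = X := Subtype.ext hX
  have hY' : (⟨φ y, h2⟩ : ℤ_[p]) = Y := Subtype.ext hY
  rw [hX', hY']

theorem reduce_of_reducesToZero {P : W.Point} (hP : ReducesToZero (NumberField.place φ) P) :
    reduce φ P = none := by
  rcases P with _ | ⟨x, y, h⟩
  · rfl
  · exact dif_neg fun h => h.1.not_gt hP

variable {W₀ : WeierstrassCurve.Affine ℤ_[p]} (hW : W.map φ = W₀.map PadicInt.Coe.ringHom)
include hW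

theorem isIntegralAt_of_map_eq : W.IsIntegralAt (NumberField.place φ) where
  a₁ := (congrArg (fun V : WeierstrassCurve ℚ_[p] => ‖V.a₁‖) hW).trans_le
    (PadicInt.norm_le_one W₀.a₁)
  a₂ := (congrArg (fun V : WeierstrassCurve ℚ_[p] => ‖V.a₂‖) hW).trans_le
    (PadicInt.norm_le_one W₀.a₂)
  a₃ := (congrArg (fun V : WeierstrassCurve ℚ_[p] => ‖V.a₃‖) hW).trans_le
    (PadicInt.norm_le_one W₀.a₃)
  a₄ := (congrArg (fun V : WeierstrassCurve ℚ_[p] => ‖V.a₄‖) hW).trans_le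
    (PadicInt.norm_le_one W₀.a₄)
  a₆ := (congrArg (fun V : WeierstrassCurve ℚ_[p] => ‖V.a₆‖) hW).trans_le
    (PadicInt.norm_le_one W₀.a₆)

theorem exists_padicInt_of_equation {x y : F} (h : W.Equation x y)
    (hx : NumberField.place φ x ≤ 1) :
    ∃ X Y : ℤ_[p], φ x = X ∧ φ y = Y ∧ W₀.Equation X Y := by
  have hy := (isIntegralAt_of_map_eq hW).y_le_one (isNonarchimedean_place φ) h hx
  refine ⟨⟨φ x, hx⟩, ⟨φ y, hy⟩, rfl, rfl, ?_⟩
  refine (map_equation _ (f := PadicInt.Coe.ringHom) Subtype.val_injective _ _).mp ?_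
  have := h.map φ
  rw [hW] at this
  exact this

theorem not_reducesToZero {x y : F} {h : W.Nonsingular x y}
    (hP : ¬ ReducesToZero (NumberField.place φ) (Point.some x y h)) :
    ∃ X Y : ℤ_[p], φ x = X ∧ φ y = Y ∧ W₀.Equation X Y ∧
      reduce φ (Point.some x y h) = some (PadicInt.toZMod X, PadicInt.toZMod Y) := by
  obtain ⟨X, Y, hX, hY, he⟩ := exists_padicInt_of_equation hW h.1 (not_lt.mp hP)
  exact ⟨X, Y, hX, hY, he, reduce_some h hX hY⟩

theorem reduce_mem (S : Finset (ZMod p × ZMod p))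
    (hS : ∀ x y, (W₀.map PadicInt.toZMod).toAffine.Equation x y → (x, y) ∈ S)
    (P : W.Point) : reduce φ P ∈ S.insertNone := by
  rw [Finset.mem_insertNone]
  intro a ha
  by_cases hP : ReducesToZero (NumberField.place φ) P
  · rw [reduce_of_reducesToZero hP] at ha; cases ha
  rcases P with _ | ⟨x, y, h⟩
  · exact absurd trivial hP
  obtain ⟨X, Y, -, -, he, hr⟩ := not_reducesToZero hW hP
  rw [hr] at ha
  cases ha
  exact hS _ _ (he.map PadicInt.toZMod)

variable [DecidableEq F]

theorem reducesToZero_sub_of_reduce_eq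
    (hns : ∀ x y, (W₀.map PadicInt.toZMod).toAffine.Equation x y →
      (W₀.map PadicInt.toZMod).toAffine.Nonsingular x y)
    {P Q : W.Point} (hP : ¬ ReducesToZero (NumberField.place φ) P)
    (hQ : ¬ ReducesToZero (NumberField.place φ) Q) (h : reduce φ P = reduce φ Q) :
    ReducesToZero (NumberField.place φ) (P - Q) := by
  rcases P with _ | ⟨x₁, y₁, h₁⟩
  · exact absurd trivial hP
  rcases Q with _ | ⟨x₂, y₂, h₂⟩
  · exact absurd trivial hQ
  obtain ⟨X₁, Y₁, hX₁, hY₁, he₁, hr₁⟩ := not_reducesToZero hW hP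
  obtain ⟨X₂, Y₂, hX₂, hY₂, he₂, hr₂⟩ := not_reducesToZero hW hQ
  rw [hr₁, hr₂, Option.some_inj, Prod.mk.injEq] at h
  have hlt : ∀ (z : F) (Z : ℤ_[p]), φ z = Z → PadicInt.toZMod Z = 0 →
      NumberField.place φ z < 1 := fun z Z hz hZ => by
    rw [NumberField.place_apply, hz]
    exact (PadicInt.norm_lt_one_iff_toZMod_eq_zero Z).mpr hZ
  have hone : ∀ (z : F) (Z : ℤ_[p]), φ z = Z → PadicInt.toZMod Z ≠ 0 →
      NumberField.place φ z = 1 := fun z Z hz hZ => by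
    rw [NumberField.place_apply, hz]
    exact le_antisymm (PadicInt.norm_le_one Z)
      (not_lt.mp fun h => hZ ((PadicInt.norm_lt_one_iff_toZMod_eq_zero Z).mp h))
  have ha₁ : φ W.a₁ = W₀.a₁ := congrArg (·.a₁) hW
  have ha₂ : φ W.a₂ = W₀.a₂ := congrArg (·.a₂) hW
  have ha₃ : φ W.a₃ = W₀.a₃ := congrArg (·.a₃) hW
  have ha₄ : φ W.a₄ = W₀.a₄ := congrArg (·.a₄) hW
  refine reducesToZero_sub (isNonarchimedean_place φ) (isIntegralAt_of_map_eq hW) h₁ h₂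
    (not_lt.mp hP) (not_lt.mp hQ) (hlt _ (X₁ - X₂) ?_ ?_) (hlt _ (Y₁ - Y₂) ?_ ?_) ?_
  · rw [map_sub, hX₁, hX₂, PadicInt.coe_sub]
  · rw [map_sub, h.1, sub_self]
  · rw [map_sub, hY₁, hY₂, PadicInt.coe_sub]
  · rw [map_sub, h.2, sub_self]
  obtain ⟨-, hn⟩ := (nonsingular_iff' ..).mp (hns _ _ (he₁.map PadicInt.toZMod))
  rcases hn with hn | hn
  · right
    refine hone _ (3 * X₁ ^ 2 + 2 * W₀.a₂ * X₁ + W₀.a₄ - W₀.a₁ * Y₁) ?_ fun h0 => hn ?_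
    · push_cast
      simp only [map_add, map_sub, map_mul, map_pow, map_ofNat, hX₁, hY₁, ha₁, ha₂, ha₄]
      rfl
    · rw [← neg_eq_zero, ← h0]
      simp only [map_a₁, map_a₂, map_a₄, map_add, map_sub, map_mul, map_pow, map_ofNat]
      ring
  · left
    refine hone _ (2 * Y₁ + W₀.a₁ * X₁ + W₀.a₃) ?_ fun h0 => hn ?_
    · push_cast
      simp only [map_add, map_mul, map_ofNat, hX₁, hY₁, ha₁, ha₃]
      rfl
    · rw [← h0]
      simp only [map_a₁, map_a₃, map_add, map_mul, map_ofNat]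

theorem reduce_injOn_torsion (hp : p ≠ 2)
    (hns : ∀ x y, (W₀.map PadicInt.toZMod).toAffine.Equation x y →
      (W₀.map PadicInt.toZMod).toAffine.Nonsingular x y) :
    Set.InjOn (reduce φ) (AddCommGroup.torsion W.Point : Set W.Point) := by
  have hzero : ∀ P ∈ AddCommGroup.torsion W.Point, ReducesToZero (NumberField.place φ) P →
      P = 0 := fun P hP hr => by
    obtain ⟨n, hn, hnP⟩ := isOfFinAddOrder_iff_nsmul_eq_zero.mp hP
    exact hr.eq_zero_of_nsmul_eq_zero (isNonarchimedean_place φ) (place_two φ hp)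
      (isIntegralAt_of_map_eq hW) (place_sq_lt_natCast φ) hn.ne' hnP
  have hnone : ∀ P : W.Point, reduce φ P = none → ReducesToZero (NumberField.place φ) P :=
    fun P h => by
      by_contra hP
      rcases P with _ | ⟨x, y, h₁⟩
      · exact hP trivial
      · obtain ⟨X, Y, -, -, -, hr⟩ := not_reducesToZero hW hP
        rw [hr] at h; cases h
  intro P hP Q hQ h
  by_cases hPr : ReducesToZero (NumberField.place φ) P
  · have hQr := hnone Q (h ▸ reduce_of_reducesToZero hPr)
    rw [hzero P hP hPr, hzero Q hQ hQr]
  · have hQr : ¬ ReducesToZero (NumberField.place φ) Q := fun hQr =>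
      hPr (hnone P (h.trans (reduce_of_reducesToZero hQr)))
    exact sub_eq_zero.mp (hzero _ (sub_mem hP hQ) (reducesToZero_sub_of_reduce_eq hW hns hPr hQr h))

theorem finite_torsion_and_card_le (hp : p ≠ 2) (S : Finset (ZMod p × ZMod p))
    (hS : ∀ x y, (W₀.map PadicInt.toZMod).toAffine.Equation x y → (x, y) ∈ S)
    (hns : ∀ x y, (W₀.map PadicInt.toZMod).toAffine.Equation x y →
      (W₀.map PadicInt.toZMod).toAffine.Nonsingular x y) :
    Finite (AddCommGroup.torsion W.Point) ∧
      Nat.card (AddCommGroup.torsion W.Point) ≤ S.card + 1 := by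
  let f : AddCommGroup.torsion W.Point → S.insertNone := fun P =>
    ⟨reduce φ (P : W.Point), reduce_mem hW S hS P⟩
  have hf : Function.Injective f := fun P Q h =>
    Subtype.ext (reduce_injOn_torsion hW hp hns P.2 Q.2 (congrArg Subtype.val h))
  refine ⟨Finite.of_injective f hf, (Nat.card_le_card_of_injective f hf).trans_eq ?_⟩
  rw [Nat.card_eq_fintype_card, Fintype.card_coe, Finset.card_insertNone]

theorem eq_zero_of_two_nsmul_eq_zero (hp : p ≠ 2)
    (h2 : ∀ x y, (W₀.map PadicInt.toZMod).toAffine.Equation x y →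
      2 * y + (W₀.map PadicInt.toZMod).a₁ * x + (W₀.map PadicInt.toZMod).a₃ ≠ 0)
    {P : W.Point} (hP : 2 • P = 0) : P = 0 := by
  rcases P with _ | ⟨x, y, h⟩
  · rfl
  exfalso
  rw [two_nsmul, add_eq_zero_iff_eq_neg, Point.neg_some, Point.some.injEq] at hP
  have hy : 2 * y + W.a₁ * x + W.a₃ = 0 := by
    have := hP.2
    rw [negY] at this
    linear_combination this
  have hI := isIntegralAt_of_map_eq hW
  have hna := isNonarchimedean_place φ
  have hx : NumberField.place φ x ≤ 1 := by
    by_contra! hx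
    have := abv_cubic hna (place_two φ hp) (hI.b₂ hna) (hI.b₄ hna) (hI.b₆ hna) hx
    rw [← sq_of_equation h.1, hy, zero_pow two_ne_zero, map_zero] at this
    have := pow_pos (one_pos.trans hx) 3
    linarith
  obtain ⟨X, Y, hX, hY, he⟩ := exists_padicInt_of_equation hW h.1 hx
  have ha₁ : φ W.a₁ = W₀.a₁ := congrArg (·.a₁) hW
  have ha₃ : φ W.a₃ = W₀.a₃ := congrArg (·.a₃) hW
  have h0 : 2 * Y + W₀.a₁ * X + W₀.a₃ = 0 := by
    refine Subtype.val_injective ?_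
    have := congrArg φ hy
    simp only [map_add, map_mul, map_ofNat, hX, hY, ha₁, ha₃, map_zero] at this
    exact_mod_cast this
  refine h2 _ _ (he.map PadicInt.toZMod) ?_
  have := congrArg (PadicInt.toZMod (p := p)) h0
  simpa only [map_a₁, map_a₃, map_add, map_mul, map_ofNat, map_zero] using this

end Padic

end WeierstrassCurve.Affine

namespace WeierstrassCurve.Affine

theorem exists_two_nsmul_eq {F : Type*} [Field F] [DecidableEq F] {W : WeierstrassCurve.Affine F}
    {x y : F} (h : W.Nonsingular x y) (s d x' y' : F) (hd : d * (2 * y + W.a₁ * x + W.a₃) = 1)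
    (hs : s * (2 * y + W.a₁ * x + W.a₃) = 3 * x ^ 2 + 2 * W.a₂ * x + W.a₄ - W.a₁ * y)
    (hx : x' = s ^ 2 + W.a₁ * s - W.a₂ - 2 * x)
    (hy : y' = -(s * (x' - x) + y) - W.a₁ * x' - W.a₃) :
    ∃ h', 2 • Point.some x y h = Point.some (W' := W) x' y' h' := by
  have hu : 2 * y + W.a₁ * x + W.a₃ ≠ 0 := right_ne_zero_of_mul (hd.trans_ne one_ne_zero)
  have hyn : y - W.negY x y = 2 * y + W.a₁ * x + W.a₃ := by rw [negY]; ring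
  have hne : y ≠ W.negY x y := fun h => hu (by rw [← hyn, ← h, sub_self])
  have hsl : W.slope x x y y = s := by
    rw [slope_of_Y_ne rfl hne, hyn, ← hs, mul_div_cancel_right₀ _ hu]
  have hX : W.addX x x s = x' := by rw [addX, hx]; ring
  have hY : W.addY x x y s = y' := by rw [addY, negAddY, negY, hX, hy]
  have hadd := Point.add_some (fun h => hne h.2) (h₁ := h) (h₂ := h)
  have hns := nonsingular_add h h (fun h => hne h.2)
  simp only [hsl, hX, hY] at hadd hns
  exact ⟨hns, (two_nsmul _).trans hadd⟩

/-- The Tate normal form `E(b,c)`. -/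
abbrev tateNormalForm {R : Type*} [CommRing R] (b c : R) : WeierstrassCurve.Affine R where
  a₁ := 1 - c
  a₂ := -b
  a₃ := -b
  a₄ := 0
  a₆ := 0

theorem tateNormalForm_map {R S : Type*} [CommRing R] [CommRing S] (f : R →+* S) (b c : R) :
    (tateNormalForm b c).map f = tateNormalForm (f b) (f c) := by
  ext <;> simp [tateNormalForm]

variable {F : Type*} [Field F] {a b c : F}

theorem exists_addOrderOf_tateNormalForm_eq_seventeen [CharZero F] [DecidableEq F]
    (ha : 2 * a ^ 4 - 5 * a ^ 3 - 7 * a ^ 2 + 10 * a + 8 = 0)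
    (hb : 64 * b = -2674 * a ^ 3 + 3233 * a ^ 2 + 12285 * a + 4540)
    (hc : 32 * c = -118 * a ^ 3 + 147 * a ^ 2 + 535 * a + 180) :
    ∃ P : (tateNormalForm b c).Point, addOrderOf P = 17 := by
  obtain rfl : b = 1135 / 16 + 12285 / 64 * a + 3233 / 64 * a ^ 2 - 1337 / 32 * a ^ 3 := by
    linear_combination hb / 64
  obtain rfl : c = 45 / 8 + 535 / 32 * a + 147 / 32 * a ^ 2 - 59 / 16 * a ^ 3 := by
    linear_combination hc / 32
  have hb : (-43 / 8 - 53 / 16 * a + 99 / 16 * a ^ 2 - 9 / 8 * a ^ 3) *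
      -(1135 / 16 + 12285 / 64 * a + 3233 / 64 * a ^ 2 - 1337 / 32 * a ^ 3) = 1 := by
    linear_combination (48677 / 1024 + 101295 / 1024 * a - 12033 / 512 * a ^ 2) * ha
  have h1 := nonsingular_zero
    (W := tateNormalForm (1135 / 16 + 12285 / 64 * a + 3233 / 64 * a ^ 2 - 1337 / 32 * a ^ 3)
      (45 / 8 + 535 / 32 * a + 147 / 32 * a ^ 2 - 59 / 16 * a ^ 3)) |>.mpr
    ⟨rfl, .inl (right_ne_zero_of_mul (hb.trans_ne one_ne_zero))⟩
  obtain ⟨h2, e2⟩ := exists_two_nsmul_eq h1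
    (0)
    (-43 / 8 - 53 / 16 * a + 99 / 16 * a ^ 2 - 9 / 8 * a ^ 3)
    (1135 / 16 + 12285 / 64 * a + 3233 / 64 * a ^ 2 - 1337 / 32 * a ^ 3)
    (734631 / 256 + 5453989 / 1024 * a + 1030505 / 1024 * a ^ 2 - 542913 / 512 * a ^ 3)
    (by linear_combination (48677 / 1024 + 101295 / 1024 * a - 12033 / 512 * a ^ 2) * ha)
    (by ring)
    (by ring)
    (by linear_combination (632481 / 2048 - 7129 / 2048 * a - 78883 / 1024 * a ^ 2) * ha)
  obtain ⟨h4, e4⟩ := exists_two_nsmul_eq h2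
    (149 / 8 + 655 / 32 * a + 11 / 32 * a ^ 2 - 51 / 16 * a ^ 3)
    (-2897 / 64 - 3531 / 128 * a + 6635 / 128 * a ^ 2 - 603 / 64 * a ^ 3)
    (255 / 2 + 381 / 8 * a - 287 / 8 * a ^ 2 + 7 / 4 * a ^ 3)
    (-12547 / 32 + 206471 / 128 * a + 110003 / 128 * a ^ 2 - 29435 / 64 * a ^ 3)
    (by linear_combination (-495067481 / 16384 - 7365464135 / 262144 * a + 3222643147 / 131072 *
      a ^ 2 - 253001255 / 262144 * a ^ 3 - 259544959 / 65536 * a ^ 4 + 47566449 / 65536 * a ^ 5) *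
      ha)
    (by linear_combination (166212541 / 16384 + 526068699 / 65536 * a - 41579041 / 16384 * a ^ 2
      - 167928211 / 65536 * a ^ 3 - 252067 / 16384 * a ^ 4 + 4023033 / 16384 * a ^ 5) * ha)
    (by linear_combination (-997 / 128 - 623 / 128 * a + 51 / 64 * a ^ 2) * ha)
    (by linear_combination (734825 / 2048 - 185089 / 2048 * a - 67739 / 1024 * a ^ 2) * ha)
  obtain ⟨h8, e8⟩ := exists_two_nsmul_eq h4
    (-83 / 8 + 623 / 32 * a + 411 / 32 * a ^ 2 - 99 / 16 * a ^ 3)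
    (-1877 / 32 - 4799 / 64 * a + 2227 / 64 * a ^ 2 + 825 / 32 * a ^ 3)
    (155 / 4 + 609 / 16 * a - 11 / 16 * a ^ 2 - 45 / 8 * a ^ 3)
    (1769 / 8 + 23947 / 32 * a + 7079 / 32 * a ^ 2 - 2703 / 16 * a ^ 3)
    (by linear_combination (43390097 / 4096 - 77030847 / 16384 * a - 6955611 / 8192 * a ^ 2 -
      34454543 / 16384 * a ^ 3 - 6097637 / 4096 * a ^ 4 + 340725 / 4096 * a ^ 5) * ha)
    (by linear_combination (-3552339 / 2048 + 517147 / 8192 * a - 1322549 / 2048 * a ^ 2 -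
      6608515 / 8192 * a ^ 3 + 871773 / 2048 * a ^ 4 - 40887 / 2048 * a ^ 5) * ha)
    (by linear_combination (1075 / 128 + 2847 / 128 * a - 495 / 64 * a ^ 2) * ha)
    (by linear_combination (15989 / 256 - 29045 / 256 * a + 1593 / 128 * a ^ 2) * ha)
  obtain ⟨h16, e16⟩ := exists_two_nsmul_eq h8
    (-5 + 49 / 4 * a + 27 / 4 * a ^ 2 - 7 / 2 * a ^ 3)
    (-2139 / 128 - 6953 / 256 * a + 1313 / 256 * a ^ 2 + 1659 / 128 * a ^ 3)
    (0)
    (1135 / 16 + 12285 / 64 * a + 3233 / 64 * a ^ 2 - 1337 / 32 * a ^ 3)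
    (by linear_combination (-13152529 / 32768 - 151368709 / 131072 * a + 30069237 / 65536 * a ^
      2 + 106813039 / 131072 * a ^ 3 - 7805823 / 32768 * a ^ 4 - 4404645 / 32768 * a ^ 5) * ha)
    (by linear_combination (-63373 / 512 + 1396637 / 2048 * a + 165181 / 1024 * a ^ 2 - 792931 /
      2048 * a ^ 3 - 10261 / 512 * a ^ 4 + 18585 / 512 * a ^ 5) * ha)
    (by linear_combination (-665 / 128 + 507 / 128 * a + 21 / 64 * a ^ 2) * ha)
    (by linear_combination (3319 / 64 - 437 / 64 * a - 315 / 32 * a ^ 2) * ha)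
  have : Fact (Nat.Prime 17) := ⟨by norm_num⟩
  refine ⟨Point.some 0 0 h1, addOrderOf_eq_prime ?_ (by rintro ⟨⟩)⟩
  have h17 : 17 • Point.some 0 0 h1 = 2 • 2 • 2 • 2 • Point.some 0 0 h1 + Point.some 0 0 h1 := by
    abel
  rw [h17, e2, e4, e8, e16]
  exact Point.add_of_Y_eq rfl (by rw [negY]; ring)

theorem tateNormalForm_equation_iff {b c x y : F} : (tateNormalForm b c).Equation x y ↔
    y ^ 2 + (1 - c) * x * y - b * y = x ^ 3 - b * x ^ 2 := by
  rw [equation_iff]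
  constructor <;> intro h <;> linear_combination h

theorem exists_padicInt_tateNormalForm {p : ℕ} [Fact p.Prime] (hp : p ≠ 2) (φ : F →+* ℚ_[p])
    {β : ℤ_[p]} (hφ : φ a = β)
    (ha : 2 * a ^ 4 - 5 * a ^ 3 - 7 * a ^ 2 + 10 * a + 8 = 0)
    (hb : 64 * b = -2674 * a ^ 3 + 3233 * a ^ 2 + 12285 * a + 4540)
    (hc : 32 * c = -118 * a ^ 3 + 147 * a ^ 2 + 535 * a + 180) :
    ∃ B C : ℤ_[p], (tateNormalForm b c).map φ = (tateNormalForm B C).map PadicInt.Coe.ringHom ∧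
      2 * β ^ 4 - 5 * β ^ 3 - 7 * β ^ 2 + 10 * β + 8 = 0 ∧
      64 * B = -2674 * β ^ 3 + 3233 * β ^ 2 + 12285 * β + 4540 ∧
      32 * C = -118 * β ^ 3 + 147 * β ^ 2 + 535 * β + 180 := by
  have ha' := congrArg φ ha
  have hb' := congrArg φ hb
  have hc' := congrArg φ hc
  simp only [map_add, map_sub, map_mul, map_pow, map_neg, map_ofNat, map_zero, hφ] at ha' hb' hc'
  have h2 : ‖(2 : ℚ_[p])‖ = 1 := by
    simpa only [NumberField.place_apply, map_ofNat] using place_two φ hp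
  have hb1 : ‖φ b‖ ≤ 1 := by
    have h : ‖(64 : ℚ_[p]) * φ b‖ = ‖φ b‖ := by
      rw [show (64 : ℚ_[p]) = 2 ^ 6 by norm_num, norm_mul, norm_pow, h2, one_pow, one_mul]
    rw [← h, hb']
    exact PadicInt.norm_le_one (-2674 * β ^ 3 + 3233 * β ^ 2 + 12285 * β + 4540 : ℤ_[p])
  have hc1 : ‖φ c‖ ≤ 1 := by
    have h : ‖(32 : ℚ_[p]) * φ c‖ = ‖φ c‖ := by
      rw [show (32 : ℚ_[p]) = 2 ^ 5 by norm_num, norm_mul, norm_pow, h2, one_pow, one_mul]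
    rw [← h, hc']
    exact PadicInt.norm_le_one (-118 * β ^ 3 + 147 * β ^ 2 + 535 * β + 180 : ℤ_[p])
  obtain ⟨B, hB⟩ : ∃ B : ℤ_[p], φ b = B := ⟨⟨φ b, hb1⟩, rfl⟩
  obtain ⟨C, hC⟩ : ∃ C : ℤ_[p], φ c = C := ⟨⟨φ c, hc1⟩, rfl⟩
  rw [hB] at hb'
  rw [hC] at hc'
  refine ⟨B, C, ?_, Subtype.val_injective ha', Subtype.val_injective hb',
    Subtype.val_injective hc'⟩
  rw [tateNormalForm_map, tateNormalForm_map, hB, hC]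
  rfl

theorem tateNormalForm_card_zmod_forty_three :
    ∀ r : ZMod 43, 2 * r ^ 4 - 5 * r ^ 3 - 7 * r ^ 2 + 10 * r + 8 = 0 →
    ∀ b, 64 * b = -2674 * r ^ 3 + 3233 * r ^ 2 + 12285 * r + 4540 →
    ∀ c, 32 * c = -118 * r ^ 3 + 147 * r ^ 2 + 535 * r + 180 →
    (Finset.univ.filter fun P : ZMod 43 × ZMod 43 =>
      P.2 ^ 2 + (1 - c) * P.1 * P.2 - b * P.2 = P.1 ^ 3 - b * P.1 ^ 2).card = 33 ∧
    ∀ x y : ZMod 43, y ^ 2 + (1 - c) * x * y - b * y = x ^ 3 - b * x ^ 2 →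
      (1 - c) * y - (3 * x ^ 2 + 2 * -b * x) ≠ 0 ∨ 2 * y + (1 - c) * x - b ≠ 0 := by
  decide +kernel

theorem tateNormalForm_two_torsion_zmod_fifty_three :
    ∀ r : ZMod 53, 2 * r ^ 4 - 5 * r ^ 3 - 7 * r ^ 2 + 10 * r + 8 = 0 →
    ∀ b, 64 * b = -2674 * r ^ 3 + 3233 * r ^ 2 + 12285 * r + 4540 →
    ∀ c, 32 * c = -118 * r ^ 3 + 147 * r ^ 2 + 535 * r + 180 →
    ∀ x y : ZMod 53, y ^ 2 + (1 - c) * x * y - b * y = x ^ 3 - b * x ^ 2 →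
      2 * y + (1 - c) * x - b ≠ 0 := by
  decide +kernel

theorem finite_torsion_tateNormalForm [DecidableEq F]
    (ha : 2 * a ^ 4 - 5 * a ^ 3 - 7 * a ^ 2 + 10 * a + 8 = 0)
    (hb : 64 * b = -2674 * a ^ 3 + 3233 * a ^ 2 + 12285 * a + 4540)
    (hc : 32 * c = -118 * a ^ 3 + 147 * a ^ 2 + 535 * a + 180)
    [Fact (Nat.Prime 43)] (φ : F →+* ℚ_[43]) {β : ℤ_[43]} (hφ : φ a = β) :
    Finite (AddCommGroup.torsion (tateNormalForm b c).Point) ∧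
      Nat.card (AddCommGroup.torsion (tateNormalForm b c).Point) ≤ 34 := by
  obtain ⟨B, C, hW, hβ, hB, hC⟩ := exists_padicInt_tateNormalForm (by norm_num) φ hφ ha hb hc
  have hβ' := congrArg (PadicInt.toZMod (p := 43)) hβ
  have hB' := congrArg (PadicInt.toZMod (p := 43)) hB
  have hC' := congrArg (PadicInt.toZMod (p := 43)) hC
  simp only [map_add, map_sub, map_mul, map_pow, map_neg, map_ofNat, map_zero] at hβ' hB' hC'
  obtain ⟨hcard, hns⟩ := tateNormalForm_card_zmod_forty_three _ hβ' _ hB' _ hC'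
  rw [show 34 = 33 + 1 from rfl, ← hcard]
  refine finite_torsion_and_card_le hW (by norm_num) _ (fun x y h => ?_) fun x y h => ?_
  · rw [tateNormalForm_map] at h
    exact Finset.mem_filter.mpr ⟨Finset.mem_univ _, tateNormalForm_equation_iff.mp h⟩
  · rw [tateNormalForm_map] at h ⊢
    refine (nonsingular_iff' ..).mpr ⟨h, ?_⟩
    simpa only [sub_eq_add_neg, add_zero] using hns x y (tateNormalForm_equation_iff.mp h)

theorem tateNormalForm_eq_zero_of_two_nsmul [DecidableEq F]
    (ha : 2 * a ^ 4 - 5 * a ^ 3 - 7 * a ^ 2 + 10 * a + 8 = 0)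
    (hb : 64 * b = -2674 * a ^ 3 + 3233 * a ^ 2 + 12285 * a + 4540)
    (hc : 32 * c = -118 * a ^ 3 + 147 * a ^ 2 + 535 * a + 180)
    [Fact (Nat.Prime 53)] (φ : F →+* ℚ_[53]) {β : ℤ_[53]} (hφ : φ a = β)
    {P : (tateNormalForm b c).Point} (hP : 2 • P = 0) : P = 0 := by
  obtain ⟨B, C, hW, hβ, hB, hC⟩ := exists_padicInt_tateNormalForm (by norm_num) φ hφ ha hb hc
  have hβ' := congrArg (PadicInt.toZMod (p := 53)) hβ
  have hB' := congrArg (PadicInt.toZMod (p := 53)) hB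
  have hC' := congrArg (PadicInt.toZMod (p := 53)) hC
  simp only [map_add, map_sub, map_mul, map_pow, map_neg, map_ofNat, map_zero] at hβ' hB' hC'
  refine eq_zero_of_two_nsmul_eq_zero hW (by norm_num) (fun x y h => ?_) hP
  rw [tateNormalForm_map] at h ⊢
  simpa only [sub_eq_add_neg] using
    tateNormalForm_two_torsion_zmod_fifty_three _ hβ' _ hB' _ hC' x y
      (tateNormalForm_equation_iff.mp h)

end WeierstrassCurve.Affine

theorem nonempty_addEquiv_zmod_seventeen {G : Type*} [AddCommGroup G] [Finite G]
    (hcard : Nat.card G ≤ 34) (h17 : ∃ g : G, addOrderOf g = 17) (h2 : ∀ g : G, 2 • g = 0 → g = 0) :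
    Nonempty (G ≃+ ZMod 17) := by
  obtain ⟨g, hg⟩ := h17
  obtain ⟨k, hk⟩ := hg ▸ addOrderOf_dvd_natCard g
  have hpos : 0 < Nat.card G := Nat.card_pos
  have hk2 : k ≠ 2 := by
    rintro rfl
    have : Fact (Nat.Prime 2) := ⟨Nat.prime_two⟩
    obtain ⟨t, ht⟩ := exists_prime_addOrderOf_dvd_card' (G := G) 2 (hk ▸ by norm_num)
    have h0 := h2 t (ht ▸ addOrderOf_nsmul_eq_zero t)
    rw [h0, addOrderOf_zero] at ht
    norm_num at ht
  have hk1 : k = 1 := by omega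
  have hG : Nat.card G = 17 := by rw [hk, hk1]
  have : Fact (Nat.Prime 17) := ⟨by norm_num⟩
  have : IsAddCyclic G := isAddCyclic_of_prime_card hG
  exact ⟨hG ▸ (zmodAddCyclicAddEquiv this).symm⟩

/-- Let `α ∈ ℂ` be a root of `2x⁴ - 5x³ - 7x² + 10x + 8` and `K = ℚ(α)`.
With `b₁ = -(1337/32)α³ + (3233/64)α² + (12285/64)α + 1135/16` and
`c₁ = -(59/16)α³ + (147/32)α² + (535/32)α + 45/8`, let `W` be the Tate normal form
`E(b₁,c₁)` over `K`. Then the torsion subgroup of the group of `K`-rational points of `W` is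
isomorphic to `ℤ/17ℤ`. -/
theorem tate_normal_form_torsion_seventeen_alpha
    (α : ℂ) (hα : 2 * α ^ 4 - 5 * α ^ 3 - 7 * α ^ 2 + 10 * α + 8 = 0)
    (K : IntermediateField ℚ ℂ) (hK : K = ℚ⟮α⟯)
    (b₁ c₁ : K)
    (hb₁ : (b₁ : ℂ) = -(1337 / 32) * α ^ 3 + (3233 / 64) * α ^ 2 + (12285 / 64) * α + 1135 / 16)
    (hc₁ : (c₁ : ℂ) = -(59 / 16) * α ^ 3 + (147 / 32) * α ^ 2 + (535 / 32) * α + 45 / 8)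
    (W : WeierstrassCurve.Affine K)
    (hW : W = { a₁ := 1 - c₁, a₂ := -b₁, a₃ := -b₁, a₄ := 0, a₆ := 0 }) :
    Nonempty (AddCommGroup.torsion W.Point ≃+ ZMod 17) := by
  subst hK hW
  have : Fact (Nat.Prime 43) := ⟨by norm_num⟩
  have : Fact (Nat.Prime 53) := ⟨by norm_num⟩
  obtain ⟨a, ha⟩ : ∃ a, a = IntermediateField.AdjoinSimple.gen ℚ α := ⟨_, rfl⟩
  have haα : (a : ℂ) = α := by rw [ha]; rfl
  have hα' : 2 * a ^ 4 - 5 * a ^ 3 - 7 * a ^ 2 + 10 * a + 8 = 0 :=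
    Subtype.val_injective <| by
      change 2 * (a : ℂ) ^ 4 - 5 * (a : ℂ) ^ 3 - 7 * (a : ℂ) ^ 2 + 10 * (a : ℂ) + 8 = 0
      rwa [haα]
  have hb : 64 * b₁ = -2674 * a ^ 3 + 3233 * a ^ 2 + 12285 * a + 4540 :=
    Subtype.val_injective <| by
      change 64 * (b₁ : ℂ) = -2674 * (a : ℂ) ^ 3 + 3233 * (a : ℂ) ^ 2 + 12285 * (a : ℂ) + 4540
      rw [hb₁, haα]
      ring
  have hc : 32 * c₁ = -118 * a ^ 3 + 147 * a ^ 2 + 535 * a + 180 :=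
    Subtype.val_injective <| by
      change 32 * (c₁ : ℂ) = -118 * (a : ℂ) ^ 3 + 147 * (a : ℂ) ^ 2 + 535 * (a : ℂ) + 180
      rw [hc₁, haα]
      ring
  obtain ⟨φ, β, hφ⟩ := exists_ringHom_adjoin_padic (p := 43) (by norm_num) 22 (by norm_num)
    (by norm_num) hα
  obtain ⟨ψ, γ, hψ⟩ := exists_ringHom_adjoin_padic (p := 53) (by norm_num) 16 (by norm_num)
    (by norm_num) hα
  rw [← ha] at hφ hψ
  obtain ⟨hfin, hcard⟩ := WeierstrassCurve.Affine.finite_torsion_tateNormalForm hα' hb hc φ hφ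
  refine nonempty_addEquiv_zmod_seventeen hcard ?_ fun T hT => Subtype.ext <|
    WeierstrassCurve.Affine.tateNormalForm_eq_zero_of_two_nsmul hα' hb hc ψ hψ
      (congrArg Subtype.val hT)
  obtain ⟨P, hP⟩ := WeierstrassCurve.Affine.exists_addOrderOf_tateNormalForm_eq_seventeen hα' hb hc
  have hPt : IsOfFinAddOrder P := addOrderOf_pos_iff.mp (by rw [hP]; norm_num)
  exact ⟨⟨P, hPt⟩, (AddSubgroup.addOrderOf_mk P hPt).trans hP⟩
end
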